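/- Assume conditions (i) and (ii). For every subdomain Ω′ ⊂⊂ Ω there exists a constant C, depending only on X_1,…,X_m and dist(Ω′, ∂Ω), such that every u ∈ C²(Ω) ∩ L¹(Ω) satisfying Δ_X u ≥ 0 in Ω (i.e. subharmonic with respect to the sub-Laplacian) obeys sup_{Ω′} u ≤ C ∫_Ω |u|. -/

import Mathlib

open MeasureTheory Filter Topology

noncomputable section

/-- Action of a first-order vector field with coefficient vector `c` on a function `u`:
`(Xu)(x) = ∑ j c(x)_j D_j u(x) = Du(x)·c(x)`. -/
def Xop {n : ℕ} (c : (Fin n → ℝ) → (Fin n → ℝ)) (u : (Fin n → ℝ) → ℝ)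
    (x : Fin n → ℝ) : ℝ :=
  fderiv ℝ u x (c x)

/-- Lie bracket of the coefficient vector fields `c`, `d`. -/
def vfBracket {n : ℕ} (c d : (Fin n → ℝ) → (Fin n → ℝ)) (x : Fin n → ℝ) :
    Fin n → ℝ :=
  fun l => fderiv ℝ (fun y => d y l) x (c x) - fderiv ℝ (fun y => c y l) x (d x)

/-- The sub-Laplacian `Δ_X u = ∑ i X_i X_i u`. -/
def subLap {n m : ℕ} (b : Fin m → (Fin n → ℝ) → (Fin n → ℝ))
    (u : (Fin n → ℝ) → ℝ) (x : Fin n → ℝ) : ℝ :=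
  ∑ i, Xop (b i) (Xop (b i) u) x

/-- The commutator `[X_i, X_j] u = X_i X_j u - X_j X_i u`. -/
def commOp {n m : ℕ} (b : Fin m → (Fin n → ℝ) → (Fin n → ℝ)) (i j : Fin m)
    (u : (Fin n → ℝ) → ℝ) (x : Fin n → ℝ) : ℝ :=
  Xop (b i) (Xop (b j) u) x - Xop (b j) (Xop (b i) u) x

/-- The symmetric Hessian `X_s² u = [½ (X_i X_j + X_j X_i) u]`. -/
def symmHess {n m : ℕ} (b : Fin m → (Fin n → ℝ) → (Fin n → ℝ))
    (u : (Fin n → ℝ) → ℝ) (x : Fin n → ℝ) : Matrix (Fin m) (Fin m) ℝ :=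
  fun i j => (Xop (b i) (Xop (b j) u) x + Xop (b j) (Xop (b i) u) x) / 2

theorem symmHess_isHermitian {n m : ℕ} (b : Fin m → (Fin n → ℝ) → (Fin n → ℝ))
    (u : (Fin n → ℝ) → ℝ) (x : Fin n → ℝ) : (symmHess b u x).IsHermitian := by
  unfold Matrix.IsHermitian
  ext i j
  simp only [Matrix.conjTranspose_apply, symmHess, star_trivial]
  ring

/-- Eigenvalues of the symmetric Hessian. -/
def hessEig {n m : ℕ} (b : Fin m → (Fin n → ℝ) → (Fin n → ℝ))
    (u : (Fin n → ℝ) → ℝ) (x : Fin n → ℝ) : Fin m → ℝ :=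
  (symmHess_isHermitian b u x).eigenvalues

/-- `k`-th elementary symmetric function of `m` real numbers. -/
def esymmF {m : ℕ} (k : ℕ) (lam : Fin m → ℝ) : ℝ :=
  ∑ s ∈ Finset.powersetCard k (Finset.univ : Finset (Fin m)), ∏ i ∈ s, lam i

/-- `S_{j,i}(λ)`: the `j`-th elementary symmetric function with the variable `λ_i` set to `0`. -/
def esymmDrop {m : ℕ} (j : ℕ) (i : Fin m) (lam : Fin m → ℝ) : ℝ :=
  ∑ s ∈ Finset.powersetCard j ((Finset.univ : Finset (Fin m)).erase i), ∏ l ∈ s, lam l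

/-- `u` is `k`-convex with respect to the vector fields `b` on `Ω`:
`S_j(λ(X_s²u)) ≥ 0` on `Ω` for `j = 1, …, k`. -/
def IsKConvex {n m : ℕ} (Ω : Set (Fin n → ℝ)) (b : Fin m → (Fin n → ℝ) → (Fin n → ℝ))
    (k : ℕ) (u : (Fin n → ℝ) → ℝ) : Prop :=
  ∀ x ∈ Ω, ∀ j, 1 ≤ j → j ≤ k → 0 ≤ esymmF j (hessEig b u x)

/-- `F_2[u] = S_2(λ(X_s²u))`. -/
def F2fun {n m : ℕ} (b : Fin m → (Fin n → ℝ) → (Fin n → ℝ))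
    (u : (Fin n → ℝ) → ℝ) (x : Fin n → ℝ) : ℝ :=
  esymmF 2 (hessEig b u x)

/-- `𝓔_2[u] = ∑_{i<j} ([X_i,X_j]u)²`. -/
def E2fun {n m : ℕ} (b : Fin m → (Fin n → ℝ) → (Fin n → ℝ))
    (u : (Fin n → ℝ) → ℝ) (x : Fin n → ℝ) : ℝ :=
  ∑ i : Fin m, ∑ j ∈ Finset.Ioi i, (commOp b i j u x) ^ 2

/-- `𝓕_2[u] = F_2[u] + (3/4) 𝓔_2[u]`. -/
def calF2 {n m : ℕ} (b : Fin m → (Fin n → ℝ) → (Fin n → ℝ))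
    (u : (Fin n → ℝ) → ℝ) (x : Fin n → ℝ) : ℝ :=
  F2fun b u x + (3 / 4) * E2fun b u x

/-- `|Xu|(x)`, the length of the subelliptic gradient. -/
def XgradNorm {n m : ℕ} (b : Fin m → (Fin n → ℝ) → (Fin n → ℝ))
    (u : (Fin n → ℝ) → ℝ) (x : Fin n → ℝ) : ℝ :=
  Real.sqrt (∑ i, (Xop (b i) u x) ^ 2)

/-- Condition (i): each `X_i` is divergence free, i.e. anti-self-adjoint. -/
def DivFree {n m : ℕ} (Ω : Set (Fin n → ℝ))
    (b : Fin m → (Fin n → ℝ) → (Fin n → ℝ)) : Prop :=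
  ∀ i : Fin m, ∀ x ∈ Ω, ∑ j, fderiv ℝ (fun y => b i y j) x (Pi.single j 1) = 0

/-- The set of iterated Lie brackets generated by the fields `b`. -/
inductive LieGen {n m : ℕ} (b : Fin m → (Fin n → ℝ) → (Fin n → ℝ)) :
    ((Fin n → ℝ) → (Fin n → ℝ)) → Prop
  | base (i : Fin m) : LieGen b (b i)
  | bracket {c d : (Fin n → ℝ) → (Fin n → ℝ)} :
      LieGen b c → LieGen b d → LieGen b (fun x => vfBracket c d x)

/-- Condition (ii): the Hörmander condition; iterated commutators span `ℝⁿ` at each point. -/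
def Hormander {n m : ℕ} (Ω : Set (Fin n → ℝ))
    (b : Fin m → (Fin n → ℝ) → (Fin n → ℝ)) : Prop :=
  ∀ x ∈ Ω, Submodule.span ℝ {v : Fin n → ℝ | ∃ c, LieGen b c ∧ c x = v} = ⊤

/-- Condition (iii): all second commutators `[X_i,[X_i,X_j]]` vanish. -/
def SecondCommVanish {n m : ℕ} (Ω : Set (Fin n → ℝ))
    (b : Fin m → (Fin n → ℝ) → (Fin n → ℝ)) : Prop :=
  ∀ i j : Fin m, ∀ x ∈ Ω, vfBracket (b i) (fun y => vfBracket (b i) (b j) y) x = 0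

/-- `Ω' ⊂⊂ Ω`: `Ω'` is open and compactly contained in `Ω`. -/
def CptIn {n : ℕ} (Ω' Ω : Set (Fin n → ℝ)) : Prop :=
  IsOpen Ω' ∧ IsCompact (closure Ω') ∧ closure Ω' ⊆ Ω

/-- A sub-unitary (piecewise C¹) curve on `[0,T]` with respect to the fields `b`. -/
def IsSubunitary {n m : ℕ} (b : Fin m → (Fin n → ℝ) → (Fin n → ℝ)) (T : ℝ)
    (γ : ℝ → Fin n → ℝ) : Prop :=
  ContinuousOn γ (Set.Icc 0 T) ∧
  ∃ S : Finset ℝ, ∀ t ∈ Set.Ioo 0 T, t ∉ S →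
    ∃ γ' : Fin n → ℝ, HasDerivAt γ γ' t ∧
      ∀ ξ : Fin n → ℝ, (∑ j, γ' j * ξ j) ^ 2 ≤ ∑ i, (∑ j, b i (γ t) j * ξ j) ^ 2

/-- The Carnot–Carathéodory distance associated with the fields `b`. -/
def ccDist {n m : ℕ} (b : Fin m → (Fin n → ℝ) → (Fin n → ℝ))
    (x y : Fin n → ℝ) : ℝ :=
  sInf {T : ℝ | 0 < T ∧ ∃ γ : ℝ → Fin n → ℝ,
    IsSubunitary b T γ ∧ γ 0 = x ∧ γ T = y}

/-- The C-C ball of radius `R` about `x`. -/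
def ccBall {n m : ℕ} (b : Fin m → (Fin n → ℝ) → (Fin n → ℝ))
    (x : Fin n → ℝ) (R : ℝ) : Set (Fin n → ℝ) :=
  {y | ccDist b x y < R}

/-- The doubling property `|B_{tR}(x)| ≥ C t^Q |B_R(x)|`. -/
def DoublingDim {n m : ℕ} (Ω : Set (Fin n → ℝ))
    (b : Fin m → (Fin n → ℝ) → (Fin n → ℝ)) (Q : ℕ) : Prop :=
  ∃ C > (0 : ℝ), ∃ R0 > (0 : ℝ), ∀ x ∈ Ω, ∀ t ∈ Set.Ioo (0 : ℝ) 1,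
    ∀ R : ℝ, 0 < R → R < R0 →
      C * t ^ Q * (volume (ccBall b x R)).toReal ≤ (volume (ccBall b x (t * R))).toReal

/-- `Q` is the homogeneous dimension of the system `b` in `Ω`. -/
def IsHomDim {n m : ℕ} (Ω : Set (Fin n → ℝ))
    (b : Fin m → (Fin n → ℝ) → (Fin n → ℝ)) (Q : ℕ) : Prop :=
  0 < Q ∧ DoublingDim Ω b Q ∧ ∀ Q' : ℕ, 0 < Q' → DoublingDim Ω b Q' → Q ≤ Q'

/-- The class `φ^k(Ω)` of `L¹_loc(Ω)` limits of smooth `k`-convex functions. -/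
def PhiK {n m : ℕ} (Ω : Set (Fin n → ℝ)) (b : Fin m → (Fin n → ℝ) → (Fin n → ℝ))
    (k : ℕ) (u : (Fin n → ℝ) → ℝ) : Prop :=
  LocallyIntegrableOn u Ω ∧
  ∀ Ω' : Set (Fin n → ℝ), CptIn Ω' Ω →
    ∃ us : ℕ → (Fin n → ℝ) → ℝ,
      (∀ l, ContDiffOn ℝ 2 (us l) Ω' ∧ IsKConvex Ω' b k (us l)) ∧
      ∀ K : Set (Fin n → ℝ), K ⊆ Ω' → IsCompact K →
        Tendsto (fun l => ∫ x in K, |us l x - u x|) atTop (𝓝 0)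

end

section TestFunctions

variable {n : ℕ} {F : Type*} [NormedAddCommGroup F] [NormedSpace ℝ F]

/-- Compactly supported functions of class `C^k`. -/
structure IsTest (k : ℕ∞) (f : (Fin n → ℝ) → F) : Prop where
  smooth : ContDiff ℝ k f
  supp : HasCompactSupport f

namespace IsTest

variable {k l : ℕ∞} {f g : (Fin n → ℝ) → F}

theorem continuous (hf : IsTest k f) : Continuous f := hf.smooth.continuous

theorem mono (hf : IsTest k f) (h : l ≤ k) : IsTest l f :=
  ⟨hf.smooth.of_le (by exact_mod_cast h), hf.supp⟩

theorem integrable (hf : IsTest k f) : Integrable f :=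
  hf.continuous.integrable_of_hasCompactSupport hf.supp

theorem differentiable (hf : IsTest k f) (h : 1 ≤ k) : Differentiable ℝ f :=
  hf.smooth.differentiable (by
    have : k ≠ 0 := by rintro rfl; simp at h
    exact_mod_cast this)

theorem add (hf : IsTest k f) (hg : IsTest k g) : IsTest k (fun x => f x + g x) :=
  ⟨hf.smooth.add hg.smooth, hf.supp.add hg.supp⟩

theorem neg (hf : IsTest k f) : IsTest k (fun x => -f x) :=
  ⟨hf.smooth.neg, hf.supp.neg⟩

theorem sub (hf : IsTest k f) (hg : IsTest k g) : IsTest k (fun x => f x - g x) := by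
  simpa only [sub_eq_add_neg] using hf.add hg.neg

theorem smul_left {a : (Fin n → ℝ) → ℝ} (ha : IsTest k a) (hf : ContDiff ℝ k f) :
    IsTest k (fun x => a x • f x) :=
  ⟨ha.smooth.smul hf, ha.supp.smul_right⟩

theorem smul_right {a : (Fin n → ℝ) → ℝ} (ha : ContDiff ℝ k a) (hf : IsTest k f) :
    IsTest k (fun x => a x • f x) :=
  ⟨ha.smul hf.smooth, hf.supp.smul_left⟩

theorem mul_left {a b : (Fin n → ℝ) → ℝ} (ha : IsTest k a) (hb : ContDiff ℝ k b) :
    IsTest k (fun x => a x * b x) := ha.smul_left hb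

theorem mul_right {a b : (Fin n → ℝ) → ℝ} (ha : ContDiff ℝ k a) (hb : IsTest k b) :
    IsTest k (fun x => a x * b x) := smul_right ha hb

theorem const_mul {b : (Fin n → ℝ) → ℝ} (a : ℝ) (hb : IsTest k b) :
    IsTest k (fun x => a * b x) := mul_right contDiff_const hb

theorem sum {ι : Type*} (s : Finset ι) {f : ι → (Fin n → ℝ) → F} (hf : ∀ i ∈ s, IsTest k (f i)) :
    IsTest k (fun x => ∑ i ∈ s, f i x) := by
  classical
  induction s using Finset.induction_on with
  | empty => simpa using ⟨contDiff_const, HasCompactSupport.zero⟩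
  | insert a s ha ih =>
    simp only [Finset.sum_insert ha]
    exact (hf a (by simp)).add (ih fun i hi => hf i (by simp [hi]))

theorem norm (hf : IsTest k f) : IsTest 0 (fun x => ‖f x‖) :=
  ⟨contDiff_zero.2 hf.continuous.norm, hf.supp.norm⟩

theorem abs {f : (Fin n → ℝ) → ℝ} (hf : IsTest k f) : IsTest 0 (fun x => |f x|) := hf.norm

theorem fderiv (hf : IsTest k f) (h : l + 1 ≤ k) : IsTest l (fderiv ℝ f) :=
  ⟨hf.smooth.fderiv_right (by exact_mod_cast h), hf.supp.fderiv ℝ⟩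

theorem fderiv_apply (hf : IsTest k f) (h : l + 1 ≤ k) {c : (Fin n → ℝ) → (Fin n → ℝ)}
    (hc : ContDiff ℝ l c) : IsTest l (fun x => _root_.fderiv ℝ f x (c x)) :=
  ⟨(hf.fderiv h).smooth.clm_apply hc,
    (hf.supp.fderiv ℝ).mono fun x hx hx0 => hx (by simp [hx0])⟩

theorem xop {f : (Fin n → ℝ) → ℝ} (hf : IsTest k f) (h : l + 1 ≤ k)
    {c : (Fin n → ℝ) → (Fin n → ℝ)} (hc : ContDiff ℝ l c) : IsTest l (Xop c f) :=
  hf.fderiv_apply h hc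

theorem bounded (hf : IsTest k f) : ∃ M, 0 ≤ M ∧ ∀ x, ‖f x‖ ≤ M := by
  obtain ⟨M, hM⟩ := hf.supp.exists_bound_of_continuous hf.continuous
  exact ⟨M, (norm_nonneg _).trans (hM 0), hM⟩

end IsTest

/-- The `L²` norm of a real function. -/
noncomputable def l2norm (f : (Fin n → ℝ) → ℝ) : ℝ := √(∫ x, f x ^ 2)

theorem l2norm_nonneg (f : (Fin n → ℝ) → ℝ) : 0 ≤ l2norm f := Real.sqrt_nonneg _

theorem l2norm_sq (f : (Fin n → ℝ) → ℝ) : l2norm f ^ 2 = ∫ x, f x ^ 2 :=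
  Real.sq_sqrt (integral_nonneg fun _ => sq_nonneg _)

namespace IsTest

variable {k l : ℕ∞} {f g : (Fin n → ℝ) → ℝ}

theorem mul (hf : IsTest k f) (hg : IsTest l g) : IsTest 0 (fun x => f x * g x) :=
  (hf.mono zero_le).mul_left (contDiff_zero.2 hg.continuous)

theorem sq (hf : IsTest k f) : IsTest 0 (fun x => f x ^ 2) := by
  simpa only [pow_two] using hf.mul hf

theorem abs_integral_mul_le (hf : IsTest k f) (hg : IsTest l g) :
    |∫ x, f x * g x| ≤ l2norm f * l2norm g := by
  have key : ∀ t : ℝ, 0 ≤ (∫ x, g x ^ 2) * (t * t) + (2 * ∫ x, f x * g x) * t + ∫ x, f x ^ 2 := by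
    intro t
    have : ∫ x, (f x + t * g x) ^ 2 =
        (∫ x, g x ^ 2) * (t * t) + (2 * ∫ x, f x * g x) * t + ∫ x, f x ^ 2 := by
      have e : ∀ x, (f x + t * g x) ^ 2 = (t * t) * g x ^ 2 + (2 * t) * (f x * g x) + f x ^ 2 :=
        fun x => by ring
      simp only [e]
      rw [integral_add _ hf.sq.integrable, integral_add _ ((hf.mul hg).integrable.const_mul _),
        integral_const_mul, integral_const_mul]
      · ring
      · exact hg.sq.integrable.const_mul _
      · exact (hg.sq.integrable.const_mul _).add ((hf.mul hg).integrable.const_mul _)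
    rw [← this]
    exact integral_nonneg fun _ => sq_nonneg _
  have hd := discrim_le_zero key
  rw [discrim] at hd
  refine abs_le_of_sq_le_sq ?_ (mul_nonneg (l2norm_nonneg _) (l2norm_nonneg _)) 
  rw [mul_pow, l2norm_sq, l2norm_sq]
  nlinarith

theorem l2norm_le (hg : IsTest l g) (h : ∀ x, |f x| ≤ |g x|) :
    l2norm f ≤ l2norm g := by
  refine Real.sqrt_le_sqrt (integral_mono_of_nonneg (Eventually.of_forall fun _ => sq_nonneg _)
    hg.sq.integrable (Eventually.of_forall fun x => ?_))
  exact sq_le_sq.2 (h x)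

theorem l2norm_add_le (hf : IsTest k f) (hg : IsTest l g) :
    l2norm (fun x => f x + g x) ≤ l2norm f + l2norm g := by
  refine abs_le_of_sq_le_sq' ?_ (add_nonneg (l2norm_nonneg _) (l2norm_nonneg _)) |>.2
  have h := (le_abs_self _).trans (hf.abs_integral_mul_le hg)
  have e : ∀ x, (f x + g x) ^ 2 = f x ^ 2 + 2 * (f x * g x) + g x ^ 2 := fun x => by ring
  rw [l2norm_sq]
  simp only [e]
  rw [integral_add _ hg.sq.integrable, integral_add hf.sq.integrable
    ((hf.mul hg).integrable.const_mul _), integral_const_mul, ← l2norm_sq, ← l2norm_sq]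
  · nlinarith
  · exact hf.sq.integrable.add ((hf.mul hg).integrable.const_mul _)

end IsTest

theorem l2norm_const_mul (a : ℝ) (f : (Fin n → ℝ) → ℝ) :
    l2norm (fun x => a * f x) = |a| * l2norm f := by
  simp only [l2norm, mul_pow, integral_const_mul]
  rw [Real.sqrt_mul (sq_nonneg a), Real.sqrt_sq_eq_abs]

theorem l2norm_abs (f : (Fin n → ℝ) → ℝ) : l2norm (fun x => |f x|) = l2norm f := by
  simp [l2norm]

theorem l2norm_neg (f : (Fin n → ℝ) → ℝ) : l2norm (fun x => -f x) = l2norm f := by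
  simp [l2norm]

namespace IsTest

variable {k l : ℕ∞} {f g : (Fin n → ℝ) → ℝ}

theorem l2norm_sub_le (hf : IsTest k f) (hg : IsTest l g) :
    l2norm (fun x => f x - g x) ≤ l2norm f + l2norm g := by
  have := hf.l2norm_add_le hg.neg
  rwa [l2norm_neg] at this

theorem l2norm_sum_le {ι : Type*} (s : Finset ι) {f : ι → (Fin n → ℝ) → ℝ}
    (hf : ∀ i ∈ s, IsTest k (f i)) :
    l2norm (fun x => ∑ i ∈ s, f i x) ≤ ∑ i ∈ s, l2norm (f i) := by
  classical
  induction s using Finset.induction_on with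
  | empty => simp [l2norm]
  | insert a s ha ih =>
    simp only [Finset.sum_insert ha]
    have h' : ∀ i ∈ s, IsTest k (f i) := fun i hi => hf i (by simp [hi])
    exact ((hf a (by simp)).l2norm_add_le (IsTest.sum s h')).trans (by linarith [ih h'])

/-- A function dominated by `M` times a test function. -/
theorem l2norm_le_mul (hg : IsTest l g) {M : ℝ} (hM : 0 ≤ M) (h : ∀ x, |f x| ≤ M * |g x|) :
    l2norm f ≤ M * l2norm g := by
  have := (hg.const_mul M).l2norm_le (f := f) (fun x => by
    rw [abs_mul, abs_of_nonneg hM]; exact h x)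
  rwa [l2norm_const_mul, abs_of_nonneg hM] at this

end IsTest

end TestFunctions

section Mollifier

variable {n : ℕ}

/-- The mollification `∫ ψ(z) f(x - s z) dz` of `f` at scale `s`. -/
noncomputable def mollify (ψ : (Fin n → ℝ) → ℝ) (s : ℝ) (f : (Fin n → ℝ) → ℝ)
    (x : Fin n → ℝ) : ℝ :=
  ∫ z, ψ z * f (x - s • z)

variable {k l : ℕ∞} {f ψ κ H : (Fin n → ℝ) → ℝ} {s : ℝ}

theorem mollify_eq_convolution (hs : s ≠ 0) (ψ f : (Fin n → ℝ) → ℝ) (x : Fin n → ℝ) :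
    mollify ψ s f x =
      convolution ψ (fun w => f (s • w)) (ContinuousLinearMap.mul ℝ ℝ) volume (s⁻¹ • x) := by
  simp [mollify, convolution, smul_sub, smul_smul, hs]

theorem IsTest.comp_smul (hf : IsTest k f) (hs : s ≠ 0) : IsTest k (fun w => f (s • w)) :=
  ⟨hf.smooth.comp (contDiff_const_smul s), hf.supp.comp_smul hs⟩

theorem IsTest.mollify (hf : IsTest k f) (hψ : IsTest l ψ) (hs : s ≠ 0) :
    IsTest k (mollify ψ s f) := by
  have hg := hf.comp_smul hs
  have e : _root_.mollify ψ s f = fun x => convolution ψ (fun w => f (s • w))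
      (ContinuousLinearMap.mul ℝ ℝ) volume (s⁻¹ • x) :=
    funext fun x => mollify_eq_convolution hs ψ f x
  rw [e]
  exact ⟨(hg.supp.contDiff_convolution_right _ hψ.integrable.locallyIntegrable hg.smooth).comp
    (contDiff_const_smul _),
    (hψ.supp.convolution (ContinuousLinearMap.mul ℝ ℝ) hg.supp).comp_smul (inv_ne_zero hs)⟩

theorem fderiv_mollify (hf : IsTest k f) (hk : 1 ≤ k) (hψ : IsTest l ψ) (hs : s ≠ 0)
    (x v : Fin n → ℝ) :
    fderiv ℝ (mollify ψ s f) x v = mollify ψ s (fun y => fderiv ℝ f y v) x := by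
  have hg := (hf.mono hk).comp_smul hs
  have e : mollify ψ s f = fun x => convolution ψ (fun w => f (s • w))
      (ContinuousLinearMap.mul ℝ ℝ) volume (s⁻¹ • x) :=
    funext fun x => mollify_eq_convolution hs ψ f x
  have h1 := hg.supp.hasFDerivAt_convolution_right (ContinuousLinearMap.mul ℝ ℝ)
    (μ := volume) hψ.integrable.locallyIntegrable hg.smooth (s⁻¹ • x)
  have h2 : HasFDerivAt (fun x : Fin n → ℝ => s⁻¹ • x)
      (s⁻¹ • ContinuousLinearMap.id ℝ (Fin n → ℝ)) x := (hasFDerivAt_id x).const_smul s⁻¹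
  have h3 := h1.comp x h2
  rw [e]
  have h4 := h3.fderiv
  simp only [Function.comp_def] at h4
  rw [h4]
  simp only [ContinuousLinearMap.comp_apply, smul_apply,
    ContinuousLinearMap.id_apply, ContinuousLinearMap.map_smul]
  rw [convolution_precompR_apply _ hψ.integrable.locallyIntegrable (hg.supp.fderiv ℝ)
    (hg.smooth.continuous_fderiv one_ne_zero), mollify_eq_convolution hs]
  have h5 : ∀ a, fderiv ℝ (fun w => f (s • w)) a v = s * fderiv ℝ f (s • a) v := by
    intro a
    have := ((hf.differentiable hk (s • a)).hasFDerivAt.comp a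
      ((hasFDerivAt_id a).const_smul s)).fderiv
    simp only [Function.comp_def] at this
    rw [this]; simp
  simp only [h5, convolution, ContinuousLinearMap.mul_apply', smul_eq_mul]
  rw [← integral_const_mul]
  congr 1; ext t
  field_simp

theorem continuous_translate (hf : IsTest k f) (s : ℝ) (x : Fin n → ℝ) :
    Continuous fun z => f (x - s • z) :=
  hf.continuous.comp (continuous_const.sub (continuous_const_smul s))

theorem IsTest.mul_translate (hH : IsTest l H) (hf : IsTest k f) (s : ℝ) (x : Fin n → ℝ) :
    IsTest 0 fun z => H z * f (x - s • z) :=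
  (hH.mono zero_le).mul_left (contDiff_zero.2 (continuous_translate hf s x))

/-- Integration by parts in the mollification variable. -/
theorem integral_mul_fderiv_translate (hH : IsTest l H) (hl : 1 ≤ l) (hf : IsTest k f)
    (hk : 1 ≤ k) (hs : s ≠ 0) (x v : Fin n → ℝ) :
    ∫ z, H z * fderiv ℝ f (x - s • z) v = s⁻¹ * ∫ z, fderiv ℝ H z v * f (x - s • z) := by
  have hd : ∀ z, HasFDerivAt (fun z => f (x - s • z))
      ((fderiv ℝ f (x - s • z)).comp (-(s • ContinuousLinearMap.id ℝ (Fin n → ℝ)))) z := fun z =>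
    (hf.differentiable hk _).hasFDerivAt.comp z
      (((hasFDerivAt_id z).const_smul s).const_sub x)
  have hd' : ∀ z, fderiv ℝ f (x - s • z) v = -s⁻¹ * fderiv ℝ (fun z => f (x - s • z)) z v := by
    intro z
    rw [(hd z).fderiv]
    simp
    field_simp
  have hH' : IsTest 0 (fun z => fderiv ℝ H z v) :=
    hH.fderiv_apply (by simpa using hl) contDiff_const
  have hf' : IsTest 0 (fun z => fderiv ℝ f z v) :=
    hf.fderiv_apply (by simpa using hk) contDiff_const
  have ibp := integral_mul_fderiv_eq_neg_fderiv_mul_of_integrable (μ := volume) (v := v)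
    (f := H) (g := fun z => f (x - s • z))
    (hH'.mul_translate hf s x).integrable
    (by
      have := (hH.mul_translate hf' s x).integrable.const_mul (-s)
      refine this.congr (Eventually.of_forall fun z => ?_)
      simp only [hd']
      field_simp)
    (hH.mul_translate hf s x).integrable
    (fun z _ => hH.differentiable hl z) (fun z _ => (hd z).differentiableAt)
  simp only [hd']
  have e : ∀ z, H z * (-s⁻¹ * fderiv ℝ (fun z => f (x - s • z)) z v) =
      -s⁻¹ * (H z * fderiv ℝ (fun z => f (x - s • z)) z v) := fun z => by ring
  simp only [e]
  rw [integral_const_mul, ibp]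
  ring

theorem integral_mul_sq_le (hκ : IsTest k κ) (h0 : ∀ z, 0 ≤ κ z) {g : (Fin n → ℝ) → ℝ}
    (hg : Continuous g) :
    (∫ z, κ z * g z) ^ 2 ≤ (∫ z, κ z) * ∫ z, κ z * g z ^ 2 := by
  have hr : IsTest 0 (fun z => √(κ z)) :=
    ⟨contDiff_zero.2 hκ.continuous.sqrt, hκ.supp.mono fun z hz h => hz (by simp [h])⟩
  have hrg : IsTest 0 (fun z => √(κ z) * g z) := hr.mul_left (contDiff_zero.2 hg)
  have := hr.abs_integral_mul_le hrg
  have e : ∀ z, √(κ z) * (√(κ z) * g z) = κ z * g z := fun z => by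
    rw [← mul_assoc, Real.mul_self_sqrt (h0 z)]
  simp only [e] at this
  have h2 := pow_le_pow_left₀ (abs_nonneg _) this 2
  rw [sq_abs, mul_pow, l2norm_sq, l2norm_sq] at h2
  simpa only [mul_pow, Real.sq_sqrt (h0 _)] using h2

theorem integral_mollify (hκ : IsTest l κ) (hf : IsTest k f) (s : ℝ) :
    ∫ x, mollify κ s f x = (∫ z, κ z) * ∫ x, f x := by
  unfold mollify
  rw [integral_integral_swap_of_hasCompactSupport]
  · simp only [integral_const_mul]
    rw [← integral_mul_const]
    congr 1; ext z
    rw [integral_sub_right_eq_self (fun x => f x) (s • z)]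
  · exact (hκ.continuous.comp continuous_snd).mul (hf.continuous.comp
      (continuous_fst.sub (continuous_snd.const_smul s)))
  · refine HasCompactSupport.intro (K := (fun p : (Fin n → ℝ) × (Fin n → ℝ) =>
      (p.1 + s • p.2, p.2)) '' (tsupport f ×ˢ tsupport κ)) ?_ ?_
    · exact (hf.supp.isCompact.prod hκ.supp.isCompact).image (by fun_prop)
    · rintro ⟨x, z⟩ hxz
      simp only [Function.uncurry_apply_pair]
      by_contra hne
      refine hxz ⟨(x - s • z, z), ⟨subset_tsupport _ ?_, subset_tsupport _ ?_⟩, by simp⟩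
      · exact right_ne_zero_of_mul hne
      · exact left_ne_zero_of_mul hne

/-- Operators dominated by averaging are bounded on `L²`. -/
theorem l2norm_le_of_abs_le_mollify (hκ : IsTest l κ) (h0 : ∀ z, 0 ≤ κ z) (hf : IsTest k f)
    (hs : s ≠ 0) {h : (Fin n → ℝ) → ℝ} (hh : ∀ x, |h x| ≤ mollify κ s (fun y => |f y|) x) :
    l2norm h ≤ (∫ z, κ z) * l2norm f := by
  have hI : 0 ≤ ∫ z, κ z := integral_nonneg h0
  refine abs_le_of_sq_le_sq' ?_ (mul_nonneg hI (l2norm_nonneg _)) |>.2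
  rw [l2norm_sq, mul_pow, l2norm_sq]
  calc ∫ x, h x ^ 2 ≤ ∫ x, (∫ z, κ z) * mollify κ s (fun y => f y ^ 2) x := by
        refine integral_mono_of_nonneg (Eventually.of_forall fun _ => sq_nonneg _)
          ((hf.sq.mollify hκ hs).integrable.const_mul _) (Eventually.of_forall fun x => ?_)
        have h1 := pow_le_pow_left₀ (abs_nonneg _) (hh x) 2
        rw [sq_abs] at h1
        refine h1.trans ((integral_mul_sq_le hκ h0 (continuous_translate hf.abs s x)).trans ?_)
        simp [mollify]
    _ = (∫ z, κ z) ^ 2 * ∫ x, f x ^ 2 := by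
        rw [integral_const_mul, integral_mollify hκ hf.sq]; ring

theorem l2norm_mollify_le (hψ : IsTest l ψ) (hf : IsTest k f) (hs : s ≠ 0) :
    l2norm (mollify ψ s f) ≤ (∫ z, |ψ z|) * l2norm f := by
  refine l2norm_le_of_abs_le_mollify hψ.abs (fun _ => abs_nonneg _) hf hs fun x => ?_
  refine (abs_integral_le_integral_abs).trans (le_of_eq ?_)
  simp [mollify, abs_mul]

theorem fderiv_mollify_eq (hf : IsTest k f) (hk : 1 ≤ k) (hψ : IsTest l ψ) (hl : 1 ≤ l)
    (hs : s ≠ 0) (x v : Fin n → ℝ) :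
    fderiv ℝ (mollify ψ s f) x v = s⁻¹ * mollify (fun z => fderiv ℝ ψ z v) s f x := by
  rw [fderiv_mollify hf hk hψ hs]
  exact integral_mul_fderiv_translate hψ hl hf hk hs x v

end Mollifier

section FriedrichsCommutator

variable {n : ℕ} {k l : ℕ∞} {f g ψ : (Fin n → ℝ) → ℝ} {s : ℝ} {c : (Fin n → ℝ) → (Fin n → ℝ)}

theorem clm_apply_eq_sum (A : (Fin n → ℝ) →L[ℝ] ℝ) (v : Fin n → ℝ) :
    A v = ∑ j, v j * A (Pi.single j 1) := by
  conv_lhs => rw [← Finset.univ_sum_single v]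
  rw [map_sum]
  refine Finset.sum_congr rfl fun j _ => ?_
  have : (Pi.single j (v j) : Fin n → ℝ) = v j • Pi.single j 1 := by
    rw [← Pi.single_smul]; simp
  rw [this, map_smul, smul_eq_mul]

theorem IsTest.lipschitz {F : Type*} [NormedAddCommGroup F] [NormedSpace ℝ F]
    {c : (Fin n → ℝ) → F} (hc : IsTest k c) (hk : 1 ≤ k) :
    ∃ L, 0 ≤ L ∧ (∀ x, ‖_root_.fderiv ℝ c x‖ ≤ L) ∧ ∀ x y, ‖c x - c y‖ ≤ L * ‖x - y‖ := by
  obtain ⟨L, hL, h⟩ := (hc.fderiv (l := 0) (by simpa using hk)).bounded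
  refine ⟨L, hL, h, fun x y => ?_⟩
  exact convex_univ.norm_image_sub_le_of_norm_fderiv_le (fun x _ => hc.differentiable hk x)
    (fun x _ => h x) (Set.mem_univ y) (Set.mem_univ x)

theorem norm_single_one_le (j : Fin n) : ‖(Pi.single j 1 : Fin n → ℝ)‖ ≤ 1 := by
  rw [Pi.norm_single]; simp

theorem xop_mollify_eq (hc : IsTest k c) (hk : 1 ≤ k) (hf : IsTest 1 f) (hψ : IsTest l ψ)
    (hl : 1 ≤ l) (hs : s ≠ 0) (x : Fin n → ℝ) :
    Xop c (mollify ψ s f) x = mollify ψ s (Xop c f) x +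
      s⁻¹ * ∑ j, ∫ z, fderiv ℝ (fun z => ψ z * (c x j - c (x - s • z) j)) z (Pi.single j 1) *
        f (x - s • z) := by
  have hH : ∀ j, IsTest 1 (fun z => ψ z * (c x j - c (x - s • z) j)) := fun j => by
    refine (hψ.mono hl).mul_left (contDiff_const.sub ?_)
    have h1 : ContDiff ℝ 1 c := (hc.mono hk).smooth
    have h2 : ContDiff ℝ 1 (fun z : Fin n → ℝ => c (x - s • z)) :=
      h1.comp (contDiff_const.sub (contDiff_const_smul s))
    exact (contDiff_pi.1 h2) j
  have hfj : ∀ j : Fin n, IsTest 0 (fun z => fderiv ℝ f z (Pi.single j 1)) := fun j =>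
    hf.fderiv_apply (by simp) contDiff_const
  have hX : IsTest 0 (Xop c f) := hf.xop (by simp) (hc.mono zero_le).smooth
  rw [Finset.mul_sum]
  simp only [← integral_mul_fderiv_translate (hH _) le_rfl hf le_rfl hs]
  rw [Xop, fderiv_mollify hf le_rfl hψ hs, mollify, mollify,
    ← integral_finsetSum _ fun j _ => ((hH j).mul_translate (hfj j) s x).integrable,
    ← integral_add (hψ.mul_translate hX s x).integrable
    (integrable_finsetSum _ fun j _ => ((hH j).mul_translate (hfj j) s x).integrable)]
  congr 1; ext z
  rw [Xop, clm_apply_eq_sum _ (c x), clm_apply_eq_sum _ (c (x - s • z)), Finset.mul_sum,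
    Finset.mul_sum, ← Finset.sum_add_distrib]
  refine Finset.sum_congr rfl fun j _ => ?_
  ring

/-- Friedrichs' lemma: the commutator of a vector field with a mollifier is bounded on `L²`. -/
theorem l2norm_xop_mollify_le (hc : IsTest k c) (hk : 1 ≤ k) (hψ : IsTest l ψ) (hl : 1 ≤ l) :
    ∃ C, 0 ≤ C ∧ ∀ s : ℝ, 0 < s → ∀ f, IsTest 1 f →
      l2norm (Xop c (mollify ψ s f)) ≤ C * (l2norm f + l2norm (Xop c f)) := by
  obtain ⟨L, hL, hL1, hL2⟩ := hc.lipschitz hk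
  have hψ' : IsTest 0 (fderiv ℝ ψ) := hψ.fderiv (by simpa using hl)
  set κ : (Fin n → ℝ) → ℝ := fun z => n * L * (‖z‖ * ‖fderiv ℝ ψ z‖ + |ψ z|) with hκdef
  have hκ : IsTest 0 κ :=
    ((IsTest.mul_right (contDiff_zero.2 continuous_norm) hψ'.norm).add hψ.abs).const_mul _
  have hκ0 : ∀ z, 0 ≤ κ z := fun z => by positivity
  have hI : 0 ≤ ∫ z, κ z := integral_nonneg hκ0
  have hI' : 0 ≤ ∫ z, |ψ z| := integral_nonneg fun _ => abs_nonneg _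
  refine ⟨(∫ z, |ψ z|) + ∫ z, κ z, by positivity, fun s hs f hf => ?_⟩
  have hX : IsTest 0 (Xop c f) := hf.xop (by simp) (hc.mono zero_le).smooth
  have hm := hX.mollify hψ hs.ne'
  have hXm : IsTest 0 (Xop c (mollify ψ s f)) :=
    (hf.mollify hψ hs.ne').xop (by simp) (hc.mono zero_le).smooth
  have hr := hXm.sub hm
  have key : l2norm (fun x => Xop c (mollify ψ s f) x - mollify ψ s (Xop c f) x) ≤
      (∫ z, κ z) * l2norm f := by
    refine l2norm_le_of_abs_le_mollify hκ hκ0 hf hs.ne' fun x => ?_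
    rw [xop_mollify_eq hc hk hf hψ hl hs.ne', add_sub_cancel_left, Finset.mul_sum]
    have hkf := (hκ.mul_translate hf.abs s x).integrable
    have hn : ∑ j : Fin n, (∫ z, (1 / (n : ℝ)) * (κ z * |f (x - s • z)|)) ≤
        mollify κ s (fun y => |f y|) x := by
      rw [Finset.sum_const, integral_const_mul, Finset.card_univ, Fintype.card_fin, nsmul_eq_mul,
        ← mul_assoc, mollify]
      refine mul_le_of_le_one_left (integral_nonneg fun z =>
        mul_nonneg (hκ0 z) (abs_nonneg _)) ?_
      rcases Nat.eq_zero_or_pos n with rfl | h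
      · simp
      · rw [mul_one_div_cancel (by positivity)]
    refine (Finset.abs_sum_le_sum_abs _ _).trans (le_trans (Finset.sum_le_sum fun j _ => ?_) hn)
    rw [← integral_const_mul]
    refine abs_integral_le_integral_abs.trans (integral_mono_of_nonneg
      (Eventually.of_forall fun _ => abs_nonneg _) (hkf.const_mul _)
      (Eventually.of_forall fun z => ?_))
    have hnpos : (n : ℝ) ≠ 0 := by
      have : 0 < n := Fin.pos j
      positivity
    have hcj : HasFDerivAt (fun z => c x j - c (x - s • z) j)
        (-(((ContinuousLinearMap.proj j).comp (fderiv ℝ c (x - s • z))).comp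
          (-(s • ContinuousLinearMap.id ℝ (Fin n → ℝ))))) z := by
      have h1 : HasFDerivAt (fun z : Fin n → ℝ => x - s • z)
        (-(s • ContinuousLinearMap.id ℝ (Fin n → ℝ))) z :=
        ((hasFDerivAt_id z).const_smul s).const_sub x
      have h2 : HasFDerivAt (fun y => c y j)
          ((ContinuousLinearMap.proj (R := ℝ) (φ := fun _ : Fin n => ℝ) j).comp
            (fderiv ℝ c (x - s • z))) (x - s • z) :=
        (ContinuousLinearMap.proj (R := ℝ) (φ := fun _ : Fin n => ℝ) j).hasFDerivAt.comp
          (x - s • z) (hc.differentiable hk _).hasFDerivAt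
      exact (h2.comp z h1).const_sub (c x j)
    have hprod : fderiv ℝ (fun z => ψ z * (c x j - c (x - s • z) j)) z = _ :=
      ((hψ.differentiable hl z).hasFDerivAt.mul hcj).fderiv
    simp only [hprod, add_apply, smul_apply,
      neg_apply, ContinuousLinearMap.comp_apply,
      ContinuousLinearMap.id_apply, ContinuousLinearMap.proj_apply, map_neg, map_smul, neg_neg,
      smul_eq_mul]
    have b1 : |c x j - c (x - s • z) j| ≤ L * (s * ‖z‖) := by
      have := (norm_le_pi_norm (c x - c (x - s • z)) j).trans (hL2 _ _)
      rw [sub_sub_cancel, norm_smul, Real.norm_of_nonneg hs.le] at this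
      simpa using this
    have b2 : |fderiv ℝ ψ z (Pi.single j 1)| ≤ ‖fderiv ℝ ψ z‖ :=
      ((fderiv ℝ ψ z).le_opNorm _).trans
        (mul_le_of_le_one_right (norm_nonneg _) (norm_single_one_le j))
    have b3 : |fderiv ℝ c (x - s • z) (Pi.single j 1) j| ≤ L := by
      refine (norm_le_pi_norm (fderiv ℝ c (x - s • z) (Pi.single j 1)) j).trans
        (((fderiv ℝ c (x - s • z)).le_opNorm _).trans ?_)
      exact (mul_le_of_le_one_right (norm_nonneg _) (norm_single_one_le j)).trans (hL1 _)
    have b4 : |s⁻¹ * (ψ z * (s * fderiv ℝ c (x - s • z) (Pi.single j 1) j) +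
        (c x j - c (x - s • z) j) * fderiv ℝ ψ z (Pi.single j 1))| ≤
        L * (‖z‖ * ‖fderiv ℝ ψ z‖ + |ψ z|) := by
      rw [abs_mul, abs_inv, abs_of_pos hs, inv_mul_le_iff₀ hs]
      refine (abs_add_le _ _).trans ?_
      rw [abs_mul, abs_mul, abs_mul, abs_of_pos hs]
      have c1 : |ψ z| * (s * |fderiv ℝ c (x - s • z) (Pi.single j 1) j|) ≤ |ψ z| * (s * L) := by
        gcongr
      have c2 : |c x j - c (x - s • z) j| * |fderiv ℝ ψ z (Pi.single j 1)| ≤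
        L * (s * ‖z‖) * ‖fderiv ℝ ψ z‖ := by gcongr
      nlinarith
    have e : 1 / (n : ℝ) * (κ z * |f (x - s • z)|) =
        L * (‖z‖ * ‖fderiv ℝ ψ z‖ + |ψ z|) * |f (x - s • z)| := by
      simp only [hκdef]; field_simp
    rw [e]
    rw [← mul_assoc, abs_mul]
    exact mul_le_mul_of_nonneg_right b4 (abs_nonneg _)
  have hsplit := hr.l2norm_add_le hm
  simp only [sub_add_cancel] at hsplit
  have hmb := l2norm_mollify_le hψ hX hs.ne'
  have n1 := l2norm_nonneg f
  have n2 := l2norm_nonneg (Xop c f)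
  calc _ ≤ (∫ z, κ z) * l2norm f + (∫ z, |ψ z|) * l2norm (Xop c f) :=
        hsplit.trans (add_le_add key hmb)
    _ ≤ _ := by nlinarith [mul_nonneg hI n2, mul_nonneg hI' n1]

end FriedrichsCommutator

section Brackets

variable {n : ℕ} {k l : ℕ∞} {f g : (Fin n → ℝ) → ℝ} {c d e : (Fin n → ℝ) → (Fin n → ℝ)}

theorem fderiv_coord {c : (Fin n → ℝ) → (Fin n → ℝ)} {x : Fin n → ℝ}
    (hc : DifferentiableAt ℝ c x) (v : Fin n → ℝ) (j : Fin n) :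
    fderiv ℝ (fun y => c y j) x v = fderiv ℝ c x v j := by
  have h := (ContinuousLinearMap.proj (R := ℝ) (φ := fun _ : Fin n => ℝ) j).hasFDerivAt.comp
    x hc.hasFDerivAt
  have h2 : fderiv ℝ (fun y => c y j) x = _ := h.fderiv
  rw [h2]; rfl

theorem vfBracket_eq {x : Fin n → ℝ} (hc : DifferentiableAt ℝ c x)
    (hd : DifferentiableAt ℝ d x) :
    vfBracket c d x = VectorField.lieBracket ℝ c d x := by
  ext j
  simp only [vfBracket, VectorField.lieBracket, Pi.sub_apply]
  rw [fderiv_coord hc, fderiv_coord hd]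

theorem vfBracket_eq_lieBracket (hc : IsTest ⊤ c) (hd : IsTest ⊤ d) :
    vfBracket c d = VectorField.lieBracket ℝ c d :=
  funext fun x => vfBracket_eq (hc.differentiable le_top x) (hd.differentiable le_top x)

theorem IsTest.vfBracket (hc : IsTest ⊤ c) (hd : IsTest ⊤ d) : IsTest ⊤ (vfBracket c d) := by
  rw [vfBracket_eq_lieBracket hc hd]
  exact (hd.fderiv_apply (by simp) hc.smooth).sub (hc.fderiv_apply (by simp) hd.smooth)

theorem vfBracket_jacobi (hc : IsTest ⊤ c) (hd : IsTest ⊤ d) (he : IsTest ⊤ e) :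
    vfBracket (vfBracket c d) e =
      fun x => vfBracket c (vfBracket d e) x - vfBracket d (vfBracket c e) x := by
  rw [vfBracket_eq_lieBracket (hc.vfBracket hd) he, vfBracket_eq_lieBracket hc (hd.vfBracket he),
    vfBracket_eq_lieBracket hd (hc.vfBracket he), vfBracket_eq_lieBracket hc hd,
    vfBracket_eq_lieBracket hd he, vfBracket_eq_lieBracket hc he]
  ext1 x
  rw [VectorField.leibniz_identity_lieBracket (n := ((⊤ : ℕ∞) : WithTop ℕ∞))
    (by simpa using WithTop.coe_le_coe.2 (le_top : (2 : ℕ∞) ≤ ⊤))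
    hc.smooth.contDiffAt hd.smooth.contDiffAt he.smooth.contDiffAt]
  simp

theorem xop_comm (hg : IsTest 2 g) (hc : IsTest ⊤ c) (hd : IsTest ⊤ d) (x : Fin n → ℝ) :
    Xop c (Xop d g) x - Xop d (Xop c g) x = Xop (vfBracket c d) g x := by
  rw [vfBracket_eq_lieBracket hc hd]
  have hg' : Differentiable ℝ (fderiv ℝ g) := (hg.fderiv (l := 1) (by norm_num)).differentiable
    le_rfl
  have h : ∀ {c d : (Fin n → ℝ) → (Fin n → ℝ)}, IsTest ⊤ d →
      Xop c (Xop d g) x = fderiv ℝ (fderiv ℝ g) x (c x) (d x) +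
        fderiv ℝ g x (fderiv ℝ d x (c x)) := by
    intro c d hd
    have h1 : fderiv ℝ (Xop d g) x = _ :=
      ((hg' x).hasFDerivAt.clm_apply (hd.differentiable le_top x).hasFDerivAt).fderiv
    rw [Xop, h1]
    simp [add_comm]
  rw [h hd, h hc, (hg.smooth.contDiffAt.isSymmSndFDerivAt (by simp)).eq (c x) (d x), Xop,
    VectorField.lieBracket, map_sub]
  ring

/-- The divergence of a vector field. -/
noncomputable def divergence (c : (Fin n → ℝ) → (Fin n → ℝ)) (x : Fin n → ℝ) : ℝ :=
  ∑ j, fderiv ℝ (fun y => c y j) x (Pi.single j 1)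

theorem IsTest.coord (hc : IsTest k c) (j : Fin n) : IsTest k (fun y => c y j) :=
  ⟨contDiff_pi.1 hc.smooth j, hc.supp.mono fun x hx h => hx (by simp [h])⟩

theorem IsTest.divergence (hc : IsTest k c) (h : l + 1 ≤ k) : IsTest l (divergence c) :=
  IsTest.sum _ fun j _ => (hc.coord j).fderiv_apply h contDiff_const

theorem integral_xop (hc : IsTest k c) (hk : 1 ≤ k) (hf : IsTest l f) (hl : 1 ≤ l) :
    ∫ x, Xop c f x = -∫ x, divergence c x * f x := by
  have h1 : ∀ j, IsTest 1 (fun y => c y j) := fun j => (hc.coord j).mono hk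
  have h2 : ∀ j : Fin n, IsTest 0 (fun x => fderiv ℝ f x (Pi.single j 1)) := fun j =>
    hf.fderiv_apply (by simpa using hl) contDiff_const
  have h3 : ∀ j, IsTest 0 (fun x => fderiv ℝ (fun y => c y j) x (Pi.single j 1)) := fun j =>
    (h1 j).fderiv_apply (by simp) contDiff_const
  have e1 : ∀ x, Xop c f x = ∑ j, c x j * fderiv ℝ f x (Pi.single j 1) := fun x =>
    clm_apply_eq_sum _ _
  simp only [e1, divergence, Finset.sum_mul]
  rw [integral_finsetSum _ fun j _ => ((h1 j).mul (h2 j)).integrable,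
    integral_finsetSum _ fun j _ => ((h3 j).mul hf).integrable, ← Finset.sum_neg_distrib]
  refine Finset.sum_congr rfl fun j _ => ?_
  exact integral_mul_fderiv_eq_neg_fderiv_mul_of_integrable ((h3 j).mul hf).integrable
    ((h1 j).mul (h2 j)).integrable ((h1 j).mul hf).integrable
    (fun x _ => (h1 j).differentiable le_rfl x) (fun x _ => hf.differentiable hl x)

theorem xop_mul {x : Fin n → ℝ} (hf : DifferentiableAt ℝ f x) (hg : DifferentiableAt ℝ g x) :
    Xop c (fun y => f y * g y) x = f x * Xop c g x + g x * Xop c f x := by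
  have h : fderiv ℝ (fun y => f y * g y) x = _ := (hf.hasFDerivAt.mul hg.hasFDerivAt).fderiv
  rw [Xop, h]
  simp [Xop]

theorem integral_xop_mul (hc : IsTest k c) (hk : 1 ≤ k) (hf : IsTest 1 f) (hg : IsTest 1 g) :
    ∫ x, Xop c f x * g x =
      -(∫ x, f x * Xop c g x) - ∫ x, (divergence c x * f x) * g x := by
  have hc0 := (hc.mono (zero_le (a := k))).smooth
  have hXf : IsTest 0 (Xop c f) := hf.xop (by simp) hc0
  have hXg : IsTest 0 (Xop c g) := hg.xop (by simp) hc0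
  have h := integral_xop hc hk (hf.mul_left hg.smooth) le_rfl
  simp only [xop_mul (hf.differentiable le_rfl _) (hg.differentiable le_rfl _)] at h
  rw [integral_add (hf.mul hXg).integrable (hg.mul hXf).integrable] at h
  simp only [mul_comm (g _) (Xop c f _)] at h
  simp only [mul_assoc]
  linarith

/-- The `L²` norm of the full gradient. -/
noncomputable def gradNorm (g : (Fin n → ℝ) → ℝ) : ℝ := l2norm fun x => ‖fderiv ℝ g x‖

theorem gradNorm_nonneg (g : (Fin n → ℝ) → ℝ) : 0 ≤ gradNorm g := l2norm_nonneg _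

theorem l2norm_xop_le_gradNorm (hc : IsTest k c) :
    ∃ M, 0 ≤ M ∧ ∀ g, IsTest 1 g → l2norm (Xop c g) ≤ M * gradNorm g := by
  obtain ⟨M, hM, h⟩ := hc.bounded
  refine ⟨M, hM, fun g hg => ?_⟩
  refine (hg.fderiv (l := 0) (by simp)).norm.l2norm_le_mul hM fun x => ?_
  rw [abs_norm, mul_comm]
  exact ((fderiv ℝ g x).le_opNorm _).trans
    (mul_le_mul_of_nonneg_left (h x) (norm_nonneg _))

theorem abs_integral_divergence_mul_le (hc : IsTest k c) (hk : 1 ≤ k) :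
    ∃ M, 0 ≤ M ∧ ∀ f g, IsTest 0 f → IsTest 0 g →
      |∫ x, (divergence c x * f x) * g x| ≤ M * (l2norm f * l2norm g) := by
  have hD : IsTest 0 (divergence c) := hc.divergence (by simpa using hk)
  obtain ⟨M, hM, h⟩ := hD.bounded
  refine ⟨M, hM, fun f g hf hg => ?_⟩
  refine ((hD.mul hf).abs_integral_mul_le hg).trans ?_
  rw [← mul_assoc]
  refine mul_le_mul_of_nonneg_right (hf.l2norm_le_mul hM fun x => ?_) (l2norm_nonneg _)
  rw [abs_mul]
  exact mul_le_mul_of_nonneg_right (h x) (abs_nonneg _)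

/-- The commutator estimate: `[c, d] g` is controlled in `L²` by the geometric mean of `d g` and
the first-order quantities of `g` and `c g`. -/
theorem l2norm_bracket_sq_le (hc : IsTest ⊤ c) (hd : IsTest ⊤ d) :
    ∃ K, 0 ≤ K ∧ ∀ g, IsTest 2 g → l2norm (Xop (vfBracket c d) g) ^ 2 ≤
      K * (l2norm (Xop d g) * (gradNorm (Xop c g) + gradNorm g) +
        l2norm (Xop c g) * gradNorm g) := by
  have hv := hc.vfBracket hd
  obtain ⟨Mv, hMv, bv⟩ := l2norm_xop_le_gradNorm hv
  obtain ⟨Md, hMd, bd⟩ := l2norm_xop_le_gradNorm hd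
  obtain ⟨Mcv, hMcv, bcv⟩ := l2norm_xop_le_gradNorm (hc.vfBracket hv)
  obtain ⟨Mdv, hMdv, bdv⟩ := l2norm_xop_le_gradNorm (hd.vfBracket hv)
  obtain ⟨Dc, hDc, ec⟩ := abs_integral_divergence_mul_le hc le_top
  obtain ⟨Dd, hDd, ed⟩ := abs_integral_divergence_mul_le hd le_top
  obtain ⟨Dv, hDv, ev⟩ := abs_integral_divergence_mul_le hv le_top
  refine ⟨Mv + (Mcv + Dc * Mv) + Mv + (Mdv + Dd * Mv + Dv * Md), by positivity,
    fun g hg => ?_⟩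
  set v := vfBracket c d with hvdef
  have hX : ∀ {e : (Fin n → ℝ) → (Fin n → ℝ)}, IsTest ⊤ e → IsTest 1 (Xop e g) := fun he =>
    hg.xop (by norm_num) (he.mono le_top).smooth
  have hXX : ∀ {e e' : (Fin n → ℝ) → (Fin n → ℝ)}, IsTest ⊤ e → IsTest ⊤ e' →
      IsTest 0 (Xop e (Xop e' g)) := fun he he' =>
    (hX he').xop (by simp) (he.mono le_top).smooth
  have hg1 : IsTest 1 g := hg.mono (by norm_num)
  have i1 := integral_xop_mul hc le_top (hX hd) (hX hv)
  have i2 := integral_xop_mul hd le_top (hX hc) (hX hv)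
  have i3 := integral_xop_mul hv le_top (hX hc) (hX hd)
  have j1 : ∫ x, Xop d g x * Xop c (Xop v g) x =
      (∫ x, Xop d g x * Xop v (Xop c g) x) + ∫ x, Xop d g x * Xop (vfBracket c v) g x := by
    rw [← integral_add ((hX hd).mul (hXX hv hc)).integrable
      ((hX hd).mul (hX (hc.vfBracket hv))).integrable]
    congr 1; ext x
    rw [← xop_comm hg hc hv]; ring
  have j2 : ∫ x, Xop c g x * Xop d (Xop v g) x =
      (∫ x, Xop c g x * Xop v (Xop d g) x) + ∫ x, Xop c g x * Xop (vfBracket d v) g x := by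
    rw [← integral_add ((hX hc).mul (hXX hv hd)).integrable
      ((hX hc).mul (hX (hd.vfBracket hv))).integrable]
    congr 1; ext x
    rw [← xop_comm hg hd hv]; ring
  have i0 : l2norm (Xop v g) ^ 2 =
      (∫ x, Xop c (Xop d g) x * Xop v g x) - ∫ x, Xop d (Xop c g) x * Xop v g x := by
    rw [l2norm_sq, ← integral_sub ((hXX hc hd).mul (hX hv)).integrable
      ((hXX hd hc).mul (hX hv)).integrable]
    congr 1; ext x
    rw [pow_two]
    nth_rewrite 1 [hvdef]
    rw [← xop_comm hg hc hd]; ring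
  have t1 := abs_le.1 ((hX hd).abs_integral_mul_le (hXX hv hc))
  have t2 := abs_le.1 ((hX hd).abs_integral_mul_le (hX (hc.vfBracket hv)))
  have t3 := abs_le.1 (ec _ _ ((hX hd).mono zero_le) ((hX hv).mono zero_le))
  have t4 := abs_le.1 ((hXX hv hc).abs_integral_mul_le (hX hd))
  have t5 := abs_le.1 ((hX hc).abs_integral_mul_le (hX (hd.vfBracket hv)))
  have t6 := abs_le.1 (ed _ _ ((hX hc).mono zero_le) ((hX hv).mono zero_le))
  have t7 := abs_le.1 (ev _ _ ((hX hc).mono zero_le) ((hX hd).mono zero_le))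
  have a := l2norm_nonneg (Xop d g)
  have b := l2norm_nonneg (Xop c g)
  have p := gradNorm_nonneg g
  have q := gradNorm_nonneg (Xop c g)
  have u1 := mul_le_mul_of_nonneg_left (bv _ (hX hc)) a
  have u2 := mul_le_mul_of_nonneg_left (bcv _ hg1) a
  have u3 := mul_le_mul_of_nonneg_left (mul_le_mul_of_nonneg_left (bv _ hg1) a) hDc
  have u5 := mul_le_mul_of_nonneg_left (bdv _ hg1) b
  have u6 := mul_le_mul_of_nonneg_left (mul_le_mul_of_nonneg_left (bv _ hg1) b) hDd
  have u7 := mul_le_mul_of_nonneg_left (mul_le_mul_of_nonneg_left (bd _ hg1) b) hDv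
  have main : l2norm (Xop v g) ^ 2 ≤
      l2norm (Xop d g) * (Mv * gradNorm (Xop c g)) + l2norm (Xop d g) * (Mcv * gradNorm g) +
      Dc * (l2norm (Xop d g) * (Mv * gradNorm g)) + l2norm (Xop d g) * (Mv * gradNorm (Xop c g)) +
      l2norm (Xop c g) * (Mdv * gradNorm g) + Dd * (l2norm (Xop c g) * (Mv * gradNorm g)) +
      Dv * (l2norm (Xop c g) * (Md * gradNorm g)) := by
    linarith [t1.1, t2.1, t3.1, t4.2, t5.1, t6.1, t7.2]
  refine main.trans ?_
  set A := l2norm (Xop d g) * gradNorm (Xop c g)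
  set B := l2norm (Xop d g) * gradNorm g
  set G := l2norm (Xop c g) * gradNorm g
  have hA : 0 ≤ A := by positivity
  have hB : 0 ≤ B := by positivity
  have hG : 0 ≤ G := by positivity
  have e1 : l2norm (Xop d g) * (Mv * gradNorm (Xop c g)) + l2norm (Xop d g) * (Mcv * gradNorm g) +
      Dc * (l2norm (Xop d g) * (Mv * gradNorm g)) + l2norm (Xop d g) * (Mv * gradNorm (Xop c g)) +
      l2norm (Xop c g) * (Mdv * gradNorm g) + Dd * (l2norm (Xop c g) * (Mv * gradNorm g)) +
      Dv * (l2norm (Xop c g) * (Md * gradNorm g)) =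
      (Mv + Mv) * A + (Mcv + Dc * Mv) * B + (Mdv + Dd * Mv + Dv * Md) * G := by ring
  have e2 : (Mv + (Mcv + Dc * Mv) + Mv + (Mdv + Dd * Mv + Dv * Md)) *
      (l2norm (Xop d g) * (gradNorm (Xop c g) + gradNorm g) + l2norm (Xop c g) * gradNorm g) =
      (Mv + Mv) * A + (Mcv + Dc * Mv) * B + (Mdv + Dd * Mv + Dv * Md) * G +
      ((Mcv + Dc * Mv + (Mdv + Dd * Mv + Dv * Md)) * A +
       (Mv + Mv + (Mdv + Dd * Mv + Dv * Md)) * B + (Mv + Mv + (Mcv + Dc * Mv)) * G) := by ring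
  rw [e1, e2]
  have : 0 ≤ ((Mcv + Dc * Mv + (Mdv + Dd * Mv + Dv * Md)) * A +
       (Mv + Mv + (Mdv + Dd * Mv + Dv * Md)) * B + (Mv + Mv + (Mcv + Dc * Mv)) * G) := by positivity
  linarith

end Brackets

section Gain

variable {n m : ℕ} {k l : ℕ∞} {f g φ : (Fin n → ℝ) → ℝ} {c d e : (Fin n → ℝ) → (Fin n → ℝ)}
  {b : Fin m → (Fin n → ℝ) → (Fin n → ℝ)}

/-- The subelliptic `W^{1,2}` norm. -/
noncomputable def energy (b : Fin m → (Fin n → ℝ) → (Fin n → ℝ)) (f : (Fin n → ℝ) → ℝ) : ℝ :=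
  l2norm f + ∑ i, l2norm (Xop (b i) f)

theorem l2norm_le_energy (b : Fin m → (Fin n → ℝ) → (Fin n → ℝ)) (f : (Fin n → ℝ) → ℝ) :
    l2norm f ≤ energy b f :=
  le_add_of_nonneg_right (Finset.sum_nonneg fun _ _ => l2norm_nonneg _)

theorem energy_nonneg (b : Fin m → (Fin n → ℝ) → (Fin n → ℝ)) (f : (Fin n → ℝ) → ℝ) :
    0 ≤ energy b f := (l2norm_nonneg f).trans (l2norm_le_energy b f)

theorem l2norm_xop_add_le_energy (b : Fin m → (Fin n → ℝ) → (Fin n → ℝ)) (i : Fin m)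
    (f : (Fin n → ℝ) → ℝ) : l2norm f + l2norm (Xop (b i) f) ≤ energy b f :=
  add_le_add le_rfl (Finset.single_le_sum (f := fun i => l2norm (Xop (b i) f))
    (fun _ _ => l2norm_nonneg _) (Finset.mem_univ i))

theorem norm_clm_le_sum (A : (Fin n → ℝ) →L[ℝ] ℝ) : ‖A‖ ≤ ∑ j, |A (Pi.single j 1)| := by
  refine A.opNorm_le_bound (Finset.sum_nonneg fun _ _ => abs_nonneg _) fun v => ?_
  rw [clm_apply_eq_sum A v, Real.norm_eq_abs, Finset.sum_mul]
  refine (Finset.abs_sum_le_sum_abs _ _).trans (Finset.sum_le_sum fun j _ => ?_)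
  rw [abs_mul, mul_comm]
  exact mul_le_mul_of_nonneg_left (norm_le_pi_norm v j) (abs_nonneg _)

theorem gradNorm_le_sum (hg : IsTest 1 g) :
    gradNorm g ≤ ∑ j, l2norm (fun x => fderiv ℝ g x (Pi.single j 1)) := by
  have h : ∀ j : Fin n, IsTest 0 (fun x => fderiv ℝ g x (Pi.single j 1)) := fun j =>
    hg.fderiv_apply (by simp) contDiff_const
  refine le_trans ((IsTest.sum Finset.univ fun j _ => (h j).abs).l2norm_le fun x => ?_)
    ((IsTest.l2norm_sum_le _ fun j _ => (h j).abs).trans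
      (le_of_eq (by simp only [l2norm_abs])))
  rw [abs_norm]
  exact (norm_clm_le_sum _).trans (le_abs_self _)

theorem fderiv_xop_eq (hg : IsTest 2 g) (hc : IsTest ⊤ c) (x v : Fin n → ℝ) :
    fderiv ℝ (Xop c g) x v =
      Xop c (fun y => fderiv ℝ g y v) x + Xop (fun y => fderiv ℝ c y v) g x := by
  have hg' : Differentiable ℝ (fderiv ℝ g) := (hg.fderiv (l := 1) (by norm_num)).differentiable
    le_rfl
  have h1 : fderiv ℝ (Xop c g) x = _ :=
    ((hg' x).hasFDerivAt.clm_apply (hc.differentiable le_top x).hasFDerivAt).fderiv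
  have h2 : fderiv ℝ (fun y => fderiv ℝ g y v) x = _ :=
    ((hg' x).hasFDerivAt.clm_apply (hasFDerivAt_const v x)).fderiv
  rw [h1, Xop, h2, Xop]
  simp only [ContinuousLinearMap.comp_zero, zero_add, add_apply,
    ContinuousLinearMap.comp_apply, ContinuousLinearMap.flip_apply]
  rw [(hg.smooth.contDiffAt.isSymmSndFDerivAt (by simp)).eq (c x) v]
  ring

theorem gradNorm_mollify_le (hφ : IsTest ⊤ φ) :
    ∃ C, 0 ≤ C ∧ ∀ s : ℝ, 0 < s → ∀ f, IsTest 1 f →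
      gradNorm (mollify φ s f) ≤ C * s⁻¹ * l2norm f := by
  refine ⟨∑ j : Fin n, ∫ z, |fderiv ℝ φ z (Pi.single j 1)|, Finset.sum_nonneg fun j _ =>
    integral_nonneg fun _ => abs_nonneg _, fun s hs f hf => ?_⟩
  refine (gradNorm_le_sum (hf.mollify hφ hs.ne')).trans ?_
  rw [Finset.sum_mul, Finset.sum_mul]
  refine Finset.sum_le_sum fun j _ => ?_
  have hφj : IsTest ⊤ (fun z => fderiv ℝ φ z (Pi.single j 1)) :=
    hφ.fderiv_apply (by simp) contDiff_const
  simp only [fderiv_mollify_eq hf le_rfl hφ le_top hs.ne']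
  rw [l2norm_const_mul, abs_of_pos (inv_pos.2 hs)]
  have := mul_le_mul_of_nonneg_left (l2norm_mollify_le hφj hf hs.ne') (inv_pos.2 hs).le
  linarith

theorem gradNorm_xop_mollify_le (hφ : IsTest ⊤ φ) (hc : IsTest ⊤ c) :
    ∃ C, 0 ≤ C ∧ ∀ s : ℝ, 0 < s → ∀ f, IsTest 2 f →
      gradNorm (Xop c (mollify φ s f)) ≤ C * s⁻¹ * (l2norm f + l2norm (Xop c f)) := by
  have hφj : ∀ j : Fin n, IsTest ⊤ (fun z => fderiv ℝ φ z (Pi.single j 1)) := fun j =>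
    hφ.fderiv_apply (by simp) contDiff_const
  have hcj : ∀ j : Fin n, IsTest ⊤ (fun z => fderiv ℝ c z (Pi.single j 1)) := fun j =>
    hc.fderiv_apply (by simp) contDiff_const
  choose A hA bA using fun j => l2norm_xop_mollify_le hc le_top (hφj j) le_top
  choose M hM bM using fun j => l2norm_xop_le_gradNorm (hcj j)
  obtain ⟨G, hG, bG⟩ := gradNorm_mollify_le hφ
  refine ⟨∑ j, (A j + M j * G), Finset.sum_nonneg fun j _ =>
    add_nonneg (hA j) (mul_nonneg (hM j) hG), fun s hs f hf => ?_⟩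
  have hf1 : IsTest 1 f := hf.mono (by norm_num)
  have hg := hf.mollify hφ hs.ne'
  have hg1 : IsTest 1 (mollify φ s f) := hg.mono (by norm_num)
  refine (gradNorm_le_sum (hg.xop (by norm_num) (hc.mono le_top).smooth)).trans ?_
  rw [Finset.sum_mul, Finset.sum_mul]
  refine Finset.sum_le_sum fun j _ => ?_
  simp only [fderiv_xop_eq hg hc]
  have hd : IsTest 1 (fun y => fderiv ℝ (mollify φ s f) y (Pi.single j 1)) :=
    hg.fderiv_apply (by norm_num) contDiff_const
  have h1 : IsTest 0 (Xop c fun y => fderiv ℝ (mollify φ s f) y (Pi.single j 1)) :=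
    hd.xop (by simp) (hc.mono le_top).smooth
  have h2 : IsTest 0 (Xop (fun y => fderiv ℝ c y (Pi.single j 1)) (mollify φ s f)) :=
    hg1.xop (by simp) ((hcj j).mono le_top).smooth
  refine (h1.l2norm_add_le h2).trans ?_
  have e1 : l2norm (Xop c fun y => fderiv ℝ (mollify φ s f) y (Pi.single j 1)) =
      s⁻¹ * l2norm (Xop c (mollify (fun z => fderiv ℝ φ z (Pi.single j 1)) s f)) := by
    rw [← abs_of_pos (inv_pos.2 hs), ← l2norm_const_mul]
    congr 1; ext x
    simp only [fderiv_mollify_eq hf1 le_rfl hφ le_top hs.ne']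
    have hd : fderiv ℝ (fun y => s⁻¹ * mollify (fun z => fderiv ℝ φ z (Pi.single j 1)) s f y) x
        = _ := fderiv_const_mul ((hf1.mollify (hφj j) hs.ne').differentiable le_rfl x) s⁻¹
    rw [Xop, hd]
    simp [Xop]
  have s0 := (inv_pos.2 hs).le
  have t1 := mul_le_mul_of_nonneg_left (bA j s hs f hf1) s0
  have t2 := bM j _ hg1
  have t3 := mul_le_mul_of_nonneg_left (bG s hs f hf1) (hM j)
  have t4 : 0 ≤ M j * G * s⁻¹ * l2norm (Xop c f) :=
    mul_nonneg (mul_nonneg (mul_nonneg (hM j) hG) s0) (l2norm_nonneg _)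
  rw [e1]
  nlinarith

/-- The vector field `c` gains a power of the mollification scale over the trivial estimate. -/
def Gain (b : Fin m → (Fin n → ℝ) → (Fin n → ℝ)) (φ : (Fin n → ℝ) → ℝ)
    (c : (Fin n → ℝ) → (Fin n → ℝ)) : Prop :=
  ∃ ε : ℝ, 0 < ε ∧ ε ≤ 1 ∧ ∃ C, 0 ≤ C ∧ ∀ s : ℝ, 0 < s → s ≤ 1 → ∀ f, IsTest 2 f →
    l2norm (Xop c (mollify φ s f)) ≤ C * s ^ (ε - 1) * energy b f

theorem gain_base (hφ : IsTest ⊤ φ) (hb : ∀ i, IsTest ⊤ (b i)) (i : Fin m) : Gain b φ (b i) := by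
  obtain ⟨C, hC, h⟩ := l2norm_xop_mollify_le (hb i) le_top hφ le_top
  refine ⟨1, one_pos, le_rfl, C, hC, fun s hs _ f hf => ?_⟩
  simp only [sub_self, Real.rpow_zero, mul_one]
  exact (h s hs f (hf.mono (by norm_num))).trans
    (mul_le_mul_of_nonneg_left (l2norm_xop_add_le_energy b i f) hC)

theorem Gain.smul (hc : Gain b φ c) (a : ℝ) : Gain b φ (fun x => a • c x) := by
  obtain ⟨ε, h0, h1, C, hC, h⟩ := hc
  refine ⟨ε, h0, h1, |a| * C, by positivity, fun s hs hs1 f hf => ?_⟩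
  have e : Xop (fun x => a • c x) (mollify φ s f) = fun x => a * Xop c (mollify φ s f) x := by
    ext x; simp [Xop]
  rw [e, l2norm_const_mul, mul_assoc, mul_assoc]
  exact mul_le_mul_of_nonneg_left (by simpa only [mul_assoc] using h s hs hs1 f hf) (abs_nonneg _)

theorem Gain.add (hφ : IsTest ⊤ φ) (hct : IsTest ⊤ c) (hdt : IsTest ⊤ d) (hc : Gain b φ c)
    (hd : Gain b φ d) : Gain b φ (fun x => c x + d x) := by
  obtain ⟨ε, h0, h1, C, hC, h⟩ := hc
  obtain ⟨ε', h0', h1', C', hC', h'⟩ := hd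
  refine ⟨min ε ε', lt_min h0 h0', (min_le_left _ _).trans h1, C + C', by positivity,
    fun s hs hs1 f hf => ?_⟩
  have e : Xop (fun x => c x + d x) (mollify φ s f) =
      fun x => Xop c (mollify φ s f) x + Xop d (mollify φ s f) x := by
    ext x; simp [Xop]
  have hg := hf.mollify hφ hs.ne'
  have i1 : IsTest 0 (Xop c (mollify φ s f)) := hg.xop (by norm_num) (hct.mono le_top).smooth
  have i2 : IsTest 0 (Xop d (mollify φ s f)) := hg.xop (by norm_num) (hdt.mono le_top).smooth
  rw [e]
  refine (i1.l2norm_add_le i2).trans ?_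
  have p1 : s ^ (ε - 1) ≤ s ^ (min ε ε' - 1) :=
    Real.rpow_le_rpow_of_exponent_ge hs hs1 (by linarith [min_le_left ε ε'])
  have p2 : s ^ (ε' - 1) ≤ s ^ (min ε ε' - 1) :=
    Real.rpow_le_rpow_of_exponent_ge hs hs1 (by linarith [min_le_right ε ε'])
  have hE := energy_nonneg b f
  calc _ ≤ C * s ^ (ε - 1) * energy b f + C' * s ^ (ε' - 1) * energy b f :=
        add_le_add (h s hs hs1 f hf) (h' s hs hs1 f hf)
    _ ≤ C * s ^ (min ε ε' - 1) * energy b f + C' * s ^ (min ε ε' - 1) * energy b f := by gcongr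
    _ = _ := by ring

theorem Gain.bracket (hφ : IsTest ⊤ φ) (hb : ∀ i, IsTest ⊤ (b i)) (hct : IsTest ⊤ c)
    (hc : Gain b φ c) (i : Fin m) : Gain b φ (vfBracket (b i) c) := by
  obtain ⟨ε, h0, h1, C, hC, h⟩ := hc
  obtain ⟨K, hK, bK⟩ := l2norm_bracket_sq_le (hb i) hct
  obtain ⟨A, hA, bA⟩ := l2norm_xop_mollify_le (hb i) le_top hφ le_top
  obtain ⟨G, hG, bG⟩ := gradNorm_mollify_le hφ
  obtain ⟨H, hH, bH⟩ := gradNorm_xop_mollify_le hφ (hb i)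
  refine ⟨ε / 2, by positivity, by linarith, √(K * (C * (H + G) + A * G)), Real.sqrt_nonneg _,
    fun s hs hs1 f hf => ?_⟩
  have hE := energy_nonneg b f
  have hf1 : IsTest 1 f := hf.mono (by norm_num)
  have hi := l2norm_xop_add_le_energy b i f
  have s0 := (inv_pos.2 hs).le
  have t0 := h s hs hs1 f hf
  have t1 : l2norm (Xop (b i) (mollify φ s f)) ≤ A * energy b f :=
    (bA s hs f hf1).trans (mul_le_mul_of_nonneg_left hi hA)
  have t2 : gradNorm (mollify φ s f) ≤ G * s⁻¹ * energy b f :=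
    (bG s hs f hf1).trans (mul_le_mul_of_nonneg_left (l2norm_le_energy b f) (by positivity))
  have t3 : gradNorm (Xop (b i) (mollify φ s f)) ≤ H * s⁻¹ * energy b f :=
    (bH s hs f hf).trans (mul_le_mul_of_nonneg_left hi (by positivity))
  have q : s⁻¹ ≤ s ^ (ε - 1) * s⁻¹ := by
    refine le_mul_of_one_le_left s0 (Real.one_le_rpow_of_pos_of_le_one_of_nonpos hs hs1 ?_)
    linarith
  have n1 := l2norm_nonneg (Xop c (mollify φ s f))
  have n2 := l2norm_nonneg (Xop (b i) (mollify φ s f))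
  have n3 := gradNorm_nonneg (mollify φ s f)
  have n4 := gradNorm_nonneg (Xop (b i) (mollify φ s f))
  have sp : 0 ≤ s ^ (ε - 1) := (Real.rpow_pos_of_pos hs _).le
  refine abs_le_of_sq_le_sq' ?_ (by positivity) |>.2
  have e : (√(K * (C * (H + G) + A * G)) * s ^ (ε / 2 - 1) * energy b f) ^ 2 =
      K * ((C * s ^ (ε - 1) * energy b f) * (H * s⁻¹ * energy b f + G * s⁻¹ * energy b f) +
        (A * energy b f) * (G * (s ^ (ε - 1) * s⁻¹) * energy b f)) := by
    have e2 : (s ^ (ε / 2 - 1)) ^ 2 = s ^ (ε - 1) * s⁻¹ := by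
      rw [← Real.rpow_natCast, ← Real.rpow_mul hs.le, ← Real.rpow_neg_one, ← Real.rpow_add hs]
      congr 1; push_cast; ring
    rw [mul_pow, mul_pow, Real.sq_sqrt (by positivity), e2]
    ring
  rw [e]
  refine (bK _ (hf.mollify hφ hs.ne')).trans (mul_le_mul_of_nonneg_left ?_ hK)
  have t2' : gradNorm (mollify φ s f) ≤ G * (s ^ (ε - 1) * s⁻¹) * energy b f :=
    t2.trans (by gcongr)
  gcongr

/-- Every iterated commutator of the fields `b` gains a power of the mollification scale. -/
theorem LieGen.gain (hφ : IsTest ⊤ φ) (hb : ∀ i, IsTest ⊤ (b i)) (hc : LieGen b c) :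
    (IsTest ⊤ c ∧ Gain b φ c) ∧
      ∀ d, IsTest ⊤ d → Gain b φ d → Gain b φ (vfBracket c d) := by
  induction hc with
  | base i =>
    exact ⟨⟨hb i, gain_base hφ hb i⟩, fun d hd hdg => hdg.bracket hφ hb hd i⟩
  | @bracket c d _ _ ihc ihd =>
    obtain ⟨⟨hct, -⟩, hcN⟩ := ihc
    obtain ⟨⟨hdt, hdG⟩, hdN⟩ := ihd
    refine ⟨⟨hct.vfBracket hdt, hcN d hdt hdG⟩, fun e het heG => ?_⟩
    change Gain b φ (vfBracket (vfBracket c d) e)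
    rw [vfBracket_jacobi hct hdt het]
    have h1 := hcN _ (hdt.vfBracket het) (hdN e het heG)
    have h2 := (hdN _ (hct.vfBracket het) (hcN e het heG)).smul (-1)
    have := h1.add hφ (hct.vfBracket (hdt.vfBracket het))
      (IsTest.smul_right contDiff_const (hdt.vfBracket (hct.vfBracket het))) h2
    simpa [sub_eq_add_neg] using this

theorem exists_gain_eq (hφ : IsTest ⊤ φ) (hb : ∀ i, IsTest ⊤ (b i)) {x₀ : Fin n → ℝ}
    (hspan : Submodule.span ℝ {v : Fin n → ℝ | ∃ c, LieGen b c ∧ c x₀ = v} = ⊤)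
    (v : Fin n → ℝ) : ∃ c, IsTest ⊤ c ∧ Gain b φ c ∧ c x₀ = v := by
  have hv : v ∈ Submodule.span ℝ {v : Fin n → ℝ | ∃ c, LieGen b c ∧ c x₀ = v} := by
    rw [hspan]; trivial
  induction hv using Submodule.span_induction with
  | mem v hv =>
    obtain ⟨c, hc, rfl⟩ := hv
    obtain ⟨⟨h1, h2⟩, -⟩ := hc.gain hφ hb
    exact ⟨c, h1, h2, rfl⟩
  | zero =>
    refine ⟨fun _ => 0, ⟨contDiff_const, HasCompactSupport.zero⟩,
      ⟨1, one_pos, le_rfl, 0, le_rfl, fun s _ _ f _ => ?_⟩, rfl⟩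
    have : Xop (fun _ => (0 : Fin n → ℝ)) (mollify φ s f) = fun _ => 0 := by
      ext x; simp [Xop]
    simp [this, l2norm]
  | add v w _ _ h1 h2 =>
    obtain ⟨c, hc, hcG, rfl⟩ := h1
    obtain ⟨d, hd, hdG, rfl⟩ := h2
    exact ⟨_, hc.add hd, hcG.add hφ hc hd hdG, rfl⟩
  | smul a v _ h1 =>
    obtain ⟨c, hc, hcG, rfl⟩ := h1
    exact ⟨_, IsTest.smul_right contDiff_const hc, hcG.smul a, rfl⟩

end Gain

section Approximation

variable {n : ℕ} {k l : ℕ∞} {f g h φ ψ : (Fin n → ℝ) → ℝ} {s t : ℝ}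

/-- A smooth probability density supported in the unit ball. -/
structure IsMollifier (φ : (Fin n → ℝ) → ℝ) : Prop where
  test : IsTest ⊤ φ
  nonneg : ∀ z, 0 ≤ φ z
  integral_eq : ∫ z, φ z = 1
  norm_le : ∀ z, φ z ≠ 0 → ‖z‖ ≤ 1

theorem exists_isMollifier (n : ℕ) : ∃ φ : (Fin n → ℝ) → ℝ, IsMollifier φ := by
  let B : ContDiffBump (0 : Fin n → ℝ) := ⟨1 / 2, 1, by norm_num, by norm_num⟩
  refine ⟨B.normed volume, ⟨B.contDiff_normed, B.hasCompactSupport_normed⟩,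
    B.nonneg_normed, B.integral_normed, fun z hz => ?_⟩
  have : z ∈ Function.support (B.normed volume) := hz
  rw [B.support_normed_eq] at this
  simpa using (Metric.mem_ball.1 this).le

theorem mollify_comm (hφ : IsTest k φ) (hψ : IsTest l ψ) (hf : Continuous f) (s t : ℝ) :
    mollify φ s (mollify ψ t f) = mollify ψ t (mollify φ s f) := by
  ext x
  unfold mollify
  simp only [← integral_const_mul]
  rw [integral_integral_swap_of_hasCompactSupport]
  · congr 1; ext w; congr 1; ext z
    rw [sub_right_comm]; ring
  · have := hφ.continuous
    have := hψ.continuous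
    unfold Function.uncurry
    fun_prop
  · refine HasCompactSupport.intro (hφ.supp.isCompact.prod hψ.supp.isCompact) ?_
    rintro ⟨z, w⟩ hzw
    simp only [Function.uncurry_apply_pair]
    by_contra hne
    exact hzw ⟨subset_tsupport _ (left_ne_zero_of_mul hne),
      subset_tsupport _ (left_ne_zero_of_mul (right_ne_zero_of_mul hne))⟩

theorem integral_mul_mollify (hh : IsTest k h) (hφ : IsTest l φ) (hg : Continuous g) (t : ℝ) :
    ∫ x, h x * mollify φ t g x = ∫ z, φ z * ∫ x, h x * g (x - t • z) := by
  unfold mollify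
  simp only [← integral_const_mul]
  rw [integral_integral_swap_of_hasCompactSupport]
  · congr 1; ext w; congr 1; ext z; ring
  · have := hφ.continuous
    have := hh.continuous
    unfold Function.uncurry
    fun_prop
  · refine HasCompactSupport.intro (hh.supp.isCompact.prod hφ.supp.isCompact) ?_
    rintro ⟨z, w⟩ hzw
    simp only [Function.uncurry_apply_pair]
    by_contra hne
    exact hzw ⟨subset_tsupport _ (left_ne_zero_of_mul hne),
      subset_tsupport _ (left_ne_zero_of_mul (right_ne_zero_of_mul hne))⟩

theorem IsTest.comp_neg (hg : IsTest k g) : IsTest k (fun y => g (-y)) := by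
  simpa using hg.comp_smul (s := -1) (by norm_num)

theorem gradNorm_comp_neg (g : (Fin n → ℝ) → ℝ) : gradNorm (fun y => g (-y)) = gradNorm g := by
  have e : ∀ x, ‖fderiv ℝ (fun y => g (-y)) x‖ = ‖fderiv ℝ g (-x)‖ := fun x => by
    simpa using congrArg norm (fderiv_comp_smul (𝕜 := ℝ) (f := g) (x := x) (-1 : ℝ))
  simp only [gradNorm, l2norm, e]
  rw [integral_neg_eq_self (fun x => ‖fderiv ℝ g x‖ ^ 2)]

theorem abs_integral_mul_translate_sub_le (hh : IsTest k h) (hg : IsTest 1 g)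
    (v : Fin n → ℝ) :
    |(∫ x, h x * g (x - v)) - ∫ x, h x * g x| ≤ l2norm h * gradNorm g * ‖v‖ := by
  have hm : IsTest 1 (mollify h 1 fun y => g (-y)) := hg.comp_neg.mollify hh one_ne_zero
  have e : ∀ y, mollify h 1 (fun y => g (-y)) y = ∫ x, h x * g (x - y) := fun y => by
    simp [mollify]
  have bound : ∀ y ∈ (Set.univ : Set (Fin n → ℝ)),
      ‖fderiv ℝ (mollify h 1 fun y => g (-y)) y‖ ≤ l2norm h * gradNorm g := by
    intro y _
    refine ContinuousLinearMap.opNorm_le_bound _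
      (mul_nonneg (l2norm_nonneg _) (gradNorm_nonneg _)) fun w => ?_
    rw [fderiv_mollify hg.comp_neg le_rfl hh one_ne_zero, Real.norm_eq_abs, mollify]
    have hd : IsTest 0 (fun y => fderiv ℝ (fun y => g (-y)) y w) :=
      hg.comp_neg.fderiv_apply (by simp) contDiff_const
    have hd' : IsTest 0 (fun z => fderiv ℝ (fun y => g (-y)) (y - (1 : ℝ) • z) w) := by
      refine ⟨contDiff_zero.2 (continuous_translate hd 1 y), ?_⟩
      simp only [one_smul]
      exact hd.supp.comp_homeomorph (Homeomorph.subLeft y)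
    refine (hh.abs_integral_mul_le hd').trans ?_
    rw [mul_assoc]
    refine mul_le_mul_of_nonneg_left ?_ (l2norm_nonneg _)
    have e3 : l2norm (fun z => fderiv ℝ (fun y => g (-y)) (y - (1 : ℝ) • z) w) =
        l2norm (fun y => fderiv ℝ (fun y => g (-y)) y w) := by
      simp only [l2norm, one_smul]
      rw [integral_sub_left_eq_self (fun x => (fderiv ℝ (fun y => g (-y)) x w) ^ 2)]
    rw [e3, ← gradNorm_comp_neg g, mul_comm]
    refine (hg.comp_neg.fderiv (l := 0) (by simp)).norm.l2norm_le_mul (norm_nonneg _) fun x => ?_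
    rw [abs_norm, mul_comm]
    exact (fderiv ℝ (fun y => g (-y)) x).le_opNorm w
  have := Convex.norm_image_sub_le_of_norm_fderiv_le
    (fun y _ => hm.differentiable le_rfl y) bound convex_univ (Set.mem_univ 0) (Set.mem_univ v)
  simpa only [e, sub_zero, Real.norm_eq_abs] using this

theorem l2norm_mollify_sub_le (hφ : IsMollifier φ) (hg : IsTest 1 g) (ht : 0 < t) :
    l2norm (fun x => g x - mollify φ t g x) ≤ t * gradNorm g := by
  have hm := hg.mollify hφ.test ht.ne'
  have hh := hg.sub hm
  set h := fun x => g x - mollify φ t g x with hdef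
  have key : l2norm h ^ 2 ≤ l2norm h * (t * gradNorm g) := by
    have e1 : l2norm h ^ 2 = (∫ x, h x * g x) - ∫ x, h x * mollify φ t g x := by
      rw [l2norm_sq, ← integral_sub (hh.mul hg).integrable (hh.mul hm).integrable]
      congr 1; ext x; rw [hdef]; ring
    have e2 : (∫ x, h x * g x) = ∫ z, φ z * ∫ x, h x * g x := by
      rw [integral_mul_const, hφ.integral_eq, one_mul]
    have c1 : IsTest 0 (fun z => φ z * ∫ x, h x * g (x - t • z)) := by
      refine (hφ.test.mono zero_le).mul_left (contDiff_zero.2 ?_)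
      have e : (fun z => ∫ x, h x * g (x - t • z)) =
          fun z => mollify h 1 (fun y => g (-y)) (t • z) := by
        ext z; simp [mollify]
      rw [e]
      exact (hg.comp_neg.mollify hh one_ne_zero).continuous.comp (continuous_const_smul t)
    rw [e1, e2, integral_mul_mollify hh hφ.test hg.continuous,
      ← integral_sub (hφ.test.integrable.mul_const _) c1.integrable]
    have : l2norm h * (t * gradNorm g) = ∫ z, φ z * (l2norm h * (t * gradNorm g)) := by
      rw [integral_mul_const, hφ.integral_eq, one_mul]
    rw [this]
    refine integral_mono ((hφ.test.integrable.mul_const _).sub c1.integrable)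
      (hφ.test.integrable.mul_const _) fun z => ?_
    simp only
    rw [← mul_sub]
    by_cases hz : φ z = 0
    · simp [hz]
    refine mul_le_mul_of_nonneg_left ?_ (hφ.nonneg z)
    have b1 := abs_integral_mul_translate_sub_le hh hg (t • z)
    rw [abs_sub_comm] at b1
    refine (le_abs_self _).trans (b1.trans ?_)
    rw [norm_smul, Real.norm_of_nonneg ht.le]
    have := hφ.norm_le z hz
    have h0 := mul_nonneg (mul_nonneg (l2norm_nonneg h) (gradNorm_nonneg g)) ht.le
    nlinarith
  by_contra! hlt
  have hpos : 0 < l2norm h := (mul_nonneg ht.le (gradNorm_nonneg g)).trans_lt hlt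
  nlinarith

theorem l2norm_sq_mollify_le (hφ : IsMollifier φ) :
    ∃ M, 0 ≤ M ∧ ∀ t : ℝ, 0 < t → ∀ f, IsTest 0 f →
      l2norm (mollify φ t f) ^ 2 ≤ M * (t ^ n)⁻¹ * (∫ x, |f x|) ^ 2 := by
  obtain ⟨M, hM, bM⟩ := hφ.test.bounded
  refine ⟨M, hM, fun t ht f hf => ?_⟩
  have hI : 0 ≤ ∫ x, |f x| := integral_nonneg fun _ => abs_nonneg _
  have tn : 0 < (t ^ n)⁻¹ := by positivity
  have p : ∀ x, |mollify φ t f x| ≤ mollify φ t (fun y => |f y|) x := fun x => by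
    refine (abs_integral_le_integral_abs).trans (le_of_eq ?_)
    simp [mollify, abs_mul, abs_of_nonneg (hφ.nonneg _)]
  have q : ∀ x, mollify φ t (fun y => |f y|) x ≤ M * ((t ^ n)⁻¹ * ∫ x, |f x|) := fun x => by
    have e : ∫ z, |f (x - t • z)| = (t ^ n)⁻¹ * ∫ x, |f x| := by
      rw [Measure.integral_comp_smul (μ := volume) (fun w => |f (x - w)|) t,
        integral_sub_left_eq_self (fun w => |f w|)]
      simp [abs_of_pos ht]
    rw [← e, ← integral_const_mul]
    have i0 : IsTest 0 (fun z => |f (x - t • z)|) := by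
      have h1 : IsTest 0 (fun z => |f (x - z)|) :=
        ⟨contDiff_zero.2 (by have := hf.continuous; fun_prop),
          hf.abs.supp.comp_homeomorph (Homeomorph.subLeft x)⟩
      exact h1.comp_smul ht.ne'
    refine integral_mono (hφ.test.mul i0).integrable (i0.integrable.const_mul _) fun z => ?_
    refine mul_le_mul_of_nonneg_right ?_ (abs_nonneg _)
    exact (le_abs_self _).trans (bM z)
  have hm := hf.abs.mollify hφ.test ht.ne'
  rw [l2norm_sq]
  calc ∫ x, mollify φ t f x ^ 2
      ≤ ∫ x, (M * ((t ^ n)⁻¹ * ∫ x, |f x|)) * mollify φ t (fun y => |f y|) x := by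
        refine integral_mono_of_nonneg (Eventually.of_forall fun _ => sq_nonneg _)
          (hm.integrable.const_mul _) (Eventually.of_forall fun x => ?_)
        have h1 := p x
        have h2 := q x
        have h3 := abs_nonneg (mollify φ t f x)
        simp only
        rw [← sq_abs, pow_two]
        exact mul_le_mul (h1.trans h2) h1 h3 (by positivity)
    _ = _ := by
        rw [integral_const_mul, integral_mollify hφ.test hf.abs, hφ.integral_eq]
        ring

end Approximation

section Nash

variable {n m : ℕ} {k l : ℕ∞} {f g h φ ψ : (Fin n → ℝ) → ℝ} {s t : ℝ}
  {b : Fin m → (Fin n → ℝ) → (Fin n → ℝ)} {x₀ : Fin n → ℝ}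

theorem norm_clm_le_of_near_basis (A : (Fin n → ℝ) →L[ℝ] ℝ) {v : Fin n → Fin n → ℝ}
    (hv : ∀ j, ‖v j - Pi.single j 1‖ ≤ 1 / (2 * (n + 1))) :
    ‖A‖ ≤ 2 * ∑ j, |A (v j)| := by
  have h1 : ‖A‖ ≤ ∑ j : Fin n, (|A (v j)| + ‖A‖ * (1 / (2 * (n + 1)))) := by
    refine (norm_clm_le_sum A).trans (Finset.sum_le_sum fun j _ => ?_)
    have e : A (Pi.single j 1) = A (v j) - A (v j - Pi.single j 1) := by rw [← map_sub]; simp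
    rw [e]
    refine (abs_sub _ _).trans (add_le_add le_rfl ?_)
    exact (A.le_opNorm _).trans (mul_le_mul_of_nonneg_left (hv j) (norm_nonneg A))
  rw [Finset.sum_add_distrib, Finset.sum_const, Finset.card_univ, Fintype.card_fin,
    nsmul_eq_mul] at h1
  have h2 : (n : ℝ) * (‖A‖ * (1 / (2 * (n + 1)))) ≤ ‖A‖ / 2 := by
    have : (n : ℝ) * (‖A‖ * (1 / (2 * (n + 1)))) = ‖A‖ / 2 * (n / (n + 1)) := by
      field_simp
    rw [this]
    refine mul_le_of_le_one_right (by positivity) ?_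
    rw [div_le_one (by positivity)]; linarith
  linarith

theorem mollify_eq_zero (hφ : IsMollifier φ) {ρ : ℝ} (hs : 0 < s)
    (hf : ∀ x, f x ≠ 0 → x ∈ Metric.closedBall x₀ ρ) {x : Fin n → ℝ}
    (hx : x ∉ Metric.closedBall x₀ (ρ + s)) : mollify φ s f x = 0 := by
  unfold mollify
  refine (integral_congr_ae (Eventually.of_forall fun z => ?_)).trans (integral_zero _ _)
  by_contra hne
  have h1 := hφ.norm_le z (left_ne_zero_of_mul hne)
  have h2 := hf _ (right_ne_zero_of_mul hne)
  refine hx ?_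
  rw [mem_closedBall_iff_norm] at h2 ⊢
  have e : x - x₀ = (x - s • z - x₀) + s • z := by abel
  rw [e]
  refine (norm_add_le _ _).trans (add_le_add h2 ?_)
  rw [norm_smul, Real.norm_of_nonneg hs.le]
  nlinarith

theorem gradNorm_mollify_le_energy (hφ : IsMollifier φ) (hb : ∀ i, IsTest ⊤ (b i))
    (hspan : Submodule.span ℝ {v : Fin n → ℝ | ∃ c, LieGen b c ∧ c x₀ = v} = ⊤) :
    ∃ ρ : ℝ, 0 < ρ ∧ ρ ≤ 1 ∧ ∃ ε : ℝ, 0 < ε ∧ ε ≤ 1 ∧ ∃ C, 0 ≤ C ∧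
      ∀ f, IsTest 2 f → (∀ x, f x ≠ 0 → x ∈ Metric.closedBall x₀ ρ) →
        ∀ s : ℝ, 0 < s → s ≤ ρ → gradNorm (mollify φ s f) ≤ C * s ^ (ε - 1) * energy b f := by
  choose Z hZ hG hZ0 using fun j : Fin n => exists_gain_eq hφ.test hb hspan (Pi.single j 1)
  choose ε' h0 h1 C hC hgain using hG
  obtain ⟨ε, hε, hε0⟩ : ∃ ε : ℝ, (∀ j, ε < ε' j) ∧ 0 < ε ∧ ε ≤ 1 := by
    have e1 : ∀ᶠ ε : ℝ in 𝓝[>] 0, ∀ j, ε < ε' j :=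
      eventually_all.2 fun j => nhdsWithin_le_nhds (eventually_lt_nhds (h0 j))
    have e2 : ∀ᶠ ε : ℝ in 𝓝[>] 0, ε ≤ 1 :=
      nhdsWithin_le_nhds (eventually_le_nhds one_pos)
    obtain ⟨ε, h⟩ := (e1.and (eventually_mem_nhdsWithin.and e2)).exists
    exact ⟨ε, h⟩
  obtain ⟨r, hr, hrZ⟩ : ∃ r > 0, ∀ x ∈ Metric.closedBall x₀ r, ∀ j,
      ‖Z j x - Pi.single j 1‖ ≤ 1 / (2 * (n + 1)) := by
    have : ∀ᶠ x in 𝓝 x₀, ∀ j, ‖Z j x - Pi.single j 1‖ ≤ 1 / (2 * (n + 1)) := by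
      refine eventually_all.2 fun j => ?_
      have ht : Tendsto (fun x => ‖Z j x - Pi.single j 1‖) (𝓝 x₀) (𝓝 ‖Z j x₀ - Pi.single j 1‖) :=
        ((hZ j).continuous.sub continuous_const).norm.continuousAt
      rw [hZ0 j, sub_self, norm_zero] at ht
      exact ht.eventually_le_const (by positivity)
    exact Metric.nhds_basis_closedBall.eventually_iff.1 this
  refine ⟨min (r / 2) 1, by positivity, min_le_right _ _, ε, hε0.1, hε0.2, 2 * ∑ j, C j,
    mul_nonneg zero_le_two (Finset.sum_nonneg fun j _ => hC j), fun f hf hsupp s hs hsρ => ?_⟩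
  have hg := hf.mollify hφ.test hs.ne'
  have hi : ∀ j, IsTest 0 (Xop (Z j) (mollify φ s f)) := fun j =>
    hg.xop (by norm_num) ((hZ j).mono le_top).smooth
  have pt : ∀ x, ‖fderiv ℝ (mollify φ s f) x‖ ≤ 2 * ∑ j, |Xop (Z j) (mollify φ s f) x| := by
    intro x
    by_cases hx : x ∈ Metric.closedBall x₀ r
    · exact norm_clm_le_of_near_basis _ (hrZ x hx)
    · have : mollify φ s f =ᶠ[𝓝 x] fun _ => 0 := by
        filter_upwards [Metric.isClosed_closedBall.isOpen_compl.mem_nhds hx] with y hy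
        refine mollify_eq_zero hφ hs hsupp fun h => hy (Metric.closedBall_subset_closedBall ?_ h)
        linarith [min_le_left (r / 2) 1]
      rw [this.fderiv_eq]
      simp only [fderiv_fun_const, Pi.zero_apply, norm_zero]
      exact mul_nonneg zero_le_two (Finset.sum_nonneg fun j _ => abs_nonneg _)
  have b1 : gradNorm (mollify φ s f) ≤ 2 * ∑ j, l2norm (Xop (Z j) (mollify φ s f)) := by
    refine ((IsTest.sum Finset.univ fun j _ => (hi j).abs).l2norm_le_mul zero_le_two
      fun x => ?_).trans (mul_le_mul_of_nonneg_left ((IsTest.l2norm_sum_le _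
        fun j _ => (hi j).abs).trans (le_of_eq (by simp only [l2norm_abs]))) zero_le_two)
    rw [abs_norm, abs_of_nonneg (Finset.sum_nonneg fun j _ => abs_nonneg _)]
    exact pt x
  refine b1.trans ?_
  rw [mul_assoc, mul_assoc]
  refine mul_le_mul_of_nonneg_left ?_ zero_le_two
  rw [Finset.sum_mul]
  refine Finset.sum_le_sum fun j _ => ?_
  have hs1 : s ≤ 1 := hsρ.trans (min_le_right _ _)
  refine (hgain j s hs hs1 f hf).trans ?_
  rw [mul_assoc]
  refine mul_le_mul_of_nonneg_left (mul_le_mul_of_nonneg_right ?_ (energy_nonneg b f)) (hC j)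
  exact Real.rpow_le_rpow_of_exponent_ge hs hs1 (by linarith [hε j])

/-- A power gain for the gradient of mollifications gives a fractional approximation rate. -/
theorem l2norm_sub_mollify_le (hφ : IsMollifier φ) {ε C E ρ : ℝ} (hε : 0 < ε)
    (hC : 0 ≤ C) (hE : 0 ≤ E) (hf : IsTest 1 f)
    (hgrad : ∀ s : ℝ, 0 < s → s ≤ ρ → gradNorm (mollify φ s f) ≤ C * s ^ (ε - 1) * E)
    (ht : 0 < t) (htρ : t ≤ ρ) :
    l2norm (fun x => f x - mollify φ t f x) ≤
      3 * C / (1 - (1 / 2) ^ ε) * t ^ ε * E := by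
  set θ : ℝ := (1 / 2) ^ ε with hθ
  have θ0 : 0 < θ := by positivity
  have θ1 : θ < 1 := Real.rpow_lt_one (by norm_num) (by norm_num) hε
  set K := 3 * C / (1 - θ) with hK
  have K0 : 0 ≤ K := div_nonneg (by positivity) (by linarith)
  set D : ℝ → ℝ := fun t => l2norm (fun x => f x - mollify φ t f x) with hD
  have step : ∀ t, 0 < t → t ≤ ρ → D t ≤ D (t / 2) + 3 * C * t ^ ε * E := by
    intro t ht htρ
    have ht2 : 0 < t / 2 := by positivity
    have m1 := hf.mollify hφ.test ht.ne'
    have m2 := hf.mollify hφ.test ht2.ne'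
    have m12 := m1.mollify hφ.test ht2.ne'
    have m21 := m2.mollify hφ.test ht.ne'
    have a1 := l2norm_mollify_sub_le hφ m2 ht
    have a2 := l2norm_mollify_sub_le hφ m1 ht2
    have g1 := mul_le_mul_of_nonneg_left (hgrad (t / 2) ht2 (by linarith)) ht.le
    have g2 := mul_le_mul_of_nonneg_left (hgrad t ht htρ) ht2.le
    have e1 : t * (t / 2) ^ (ε - 1) ≤ 2 * t ^ ε := by
      have : t * (t / 2) ^ (ε - 1) = 2 * (t / 2) ^ ε := by
        rw [Real.rpow_sub_one ht2.ne']; field_simp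
      rw [this]
      exact mul_le_mul_of_nonneg_left (Real.rpow_le_rpow ht2.le (by linarith) hε.le) zero_le_two
    have e2 : t / 2 * t ^ (ε - 1) = t ^ ε / 2 := by
      rw [Real.rpow_sub_one ht.ne']; field_simp
    have q1 : t * (C * (t / 2) ^ (ε - 1) * E) ≤ 2 * (C * t ^ ε * E) := by
      have := mul_le_mul_of_nonneg_left e1 (mul_nonneg hC hE)
      linarith
    have q2 : t / 2 * (C * t ^ (ε - 1) * E) ≤ C * t ^ ε * E := by
      have : t / 2 * (C * t ^ (ε - 1) * E) = C * (t / 2 * t ^ (ε - 1)) * E := by ring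
      rw [this, e2]
      have : 0 ≤ C * t ^ ε * E := by positivity
      linarith
    have dec : (fun x => f x - mollify φ t f x) = fun x =>
        (f x - mollify φ (t / 2) f x) +
          ((mollify φ (t / 2) f x - mollify φ t (mollify φ (t / 2) f) x) -
            (mollify φ t f x - mollify φ (t / 2) (mollify φ t f) x)) := by
      ext x
      rw [mollify_comm hφ.test hφ.test hf.continuous t (t / 2)]
      ring
    calc D t ≤ D (t / 2) + (l2norm (fun x => mollify φ (t / 2) f x -
            mollify φ t (mollify φ (t / 2) f) x) +
          l2norm (fun x => mollify φ t f x - mollify φ (t / 2) (mollify φ t f) x)) := by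
          simp only [hD]
          rw [dec]
          exact ((hf.sub m2).l2norm_add_le ((m2.sub m21).sub (m1.sub m12))).trans
            (add_le_add le_rfl ((m2.sub m21).l2norm_sub_le (m1.sub m12)))
      _ ≤ D (t / 2) + 3 * C * t ^ ε * E := by linarith
  have iter : ∀ k : ℕ, ∀ t, 0 < t → t ≤ ρ → D t ≤ D (t / 2 ^ k) + K * t ^ ε * E := by
    intro k
    induction k with
    | zero =>
      intro t ht _
      have : 0 ≤ K * t ^ ε * E := by positivity
      simpa using this
    | succ k ih =>
      intro t ht htρ
      have h1 := step t ht htρ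
      have h2 := ih (t / 2) (by positivity) (by linarith)
      have e : (t / 2) ^ ε = θ * t ^ ε := by
        rw [hθ, ← Real.mul_rpow (by norm_num) ht.le]; congr 1; ring
      rw [div_div, ← pow_succ', e] at h2
      have e2 : 3 * C = K * (1 - θ) := by
        rw [hK, div_mul_cancel₀]; linarith
      rw [e2] at h1
      linarith
  refine ge_of_tendsto' (x := atTop) (f := fun k : ℕ => t / 2 ^ k * gradNorm f + K * t ^ ε * E) ?_
    fun k => (iter k t ht htρ).trans (add_le_add
      (l2norm_mollify_sub_le hφ hf (by positivity)) le_rfl)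
  have : Tendsto (fun k : ℕ => t * (1 / 2) ^ k) atTop (𝓝 (t * 0)) :=
    (tendsto_pow_atTop_nhds_zero_of_lt_one (by norm_num) (by norm_num)).const_mul t
  have h2 := (this.mul_const (gradNorm f)).add_const (K * t ^ ε * E)
  simpa [div_eq_mul_inv] using h2

/-- A local Nash-type inequality near a point where the commutators span. -/
theorem exists_nash (hb : ∀ i, IsTest ⊤ (b i))
    (hspan : Submodule.span ℝ {v : Fin n → ℝ | ∃ c, LieGen b c ∧ c x₀ = v} = ⊤) :
    ∃ ρ : ℝ, 0 < ρ ∧ ∃ δ₀ : ℝ, 0 < δ₀ ∧ δ₀ ≤ 1 ∧ ∃ K, 0 ≤ K ∧ ∃ N : ℕ,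
      ∀ f, IsTest 2 f → (∀ x, f x ≠ 0 → x ∈ Metric.closedBall x₀ ρ) →
        ∀ δ : ℝ, 0 < δ → δ ≤ δ₀ →
          ∫ x, f x ^ 2 ≤ K * (δ ^ 2 * energy b f ^ 2 + (δ ^ N)⁻¹ * (∫ x, |f x|) ^ 2) := by
  obtain ⟨φ, hφ⟩ := exists_isMollifier n
  obtain ⟨ρ, hρ, hρ1, ε, hε, hε1, C, hC, hgrad⟩ := gradNorm_mollify_le_energy hφ hb hspan
  obtain ⟨M, hM, hsup⟩ := l2norm_sq_mollify_le hφ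
  set K := 3 * C / (1 - (1 / 2 : ℝ) ^ ε)
  have θ1 : (1 / 2 : ℝ) ^ ε < 1 := Real.rpow_lt_one (by norm_num) (by norm_num) hε
  have K0 : 0 ≤ K := div_nonneg (by positivity) (by linarith)
  refine ⟨ρ, hρ, ρ ^ ε, by positivity, Real.rpow_le_one hρ.le hρ1 hε.le, 2 * (K ^ 2 + M),
    by positivity, ⌈n / ε⌉₊, fun f hf hsupp δ hδ hδ0 => ?_⟩
  set t := δ ^ (1 / ε) with htdef
  have ht : 0 < t := by positivity
  have htε : t ^ ε = δ := by
    rw [htdef, ← Real.rpow_mul hδ.le, one_div_mul_cancel hε.ne', Real.rpow_one]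
  have htρ : t ≤ ρ := by
    have := Real.rpow_le_rpow hδ.le hδ0 (one_div_pos.2 hε).le
    rwa [← Real.rpow_mul hρ.le, mul_one_div_cancel hε.ne', Real.rpow_one] at this
  have hδ1 : δ ≤ 1 := hδ0.trans (Real.rpow_le_one hρ.le hρ1 hε.le)
  have tn : (t ^ n)⁻¹ ≤ (δ ^ ⌈n / ε⌉₊)⁻¹ := by
    refine inv_anti₀ (by positivity) ?_
    rw [← Real.rpow_natCast, ← Real.rpow_natCast, htdef, ← Real.rpow_mul hδ.le]
    refine Real.rpow_le_rpow_of_exponent_ge hδ hδ1 ?_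
    rw [one_div_mul_eq_div]
    exact Nat.le_ceil _
  have hf1 : IsTest 1 f := hf.mono (by norm_num)
  have h1 := l2norm_sub_mollify_le hφ hε hC (energy_nonneg b f) hf1 (hgrad f hf hsupp) ht htρ
  rw [htε] at h1
  have h2 := hsup t ht f (hf.mono zero_le)
  have hm := hf1.mollify hφ.test ht.ne'
  have h3 : l2norm f ≤ l2norm (fun x => f x - mollify φ t f x) + l2norm (mollify φ t f) := by
    have := (hf1.sub hm).l2norm_add_le hm
    simpa using this
  have h4 := pow_le_pow_left₀ (l2norm_nonneg _) h3 2
  have h5 := pow_le_pow_left₀ (l2norm_nonneg _) h1 2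
  have h6 := mul_le_mul_of_nonneg_right (mul_le_mul_of_nonneg_left tn hM)
    (sq_nonneg (∫ x, |f x|))
  rw [← l2norm_sq]
  have p1 : 0 ≤ K ^ 2 * ((δ ^ ⌈n / ε⌉₊)⁻¹ * (∫ x, |f x|) ^ 2) := by positivity
  have p2 : 0 ≤ M * (δ ^ 2 * energy b f ^ 2) := by positivity
  have h7 : (l2norm (fun x => f x - mollify φ t f x) + l2norm (mollify φ t f)) ^ 2 ≤
    2 * l2norm (fun x => f x - mollify φ t f x) ^ 2 + 2 * l2norm (mollify φ t f) ^ 2 := by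
    nlinarith [sq_nonneg (l2norm (fun x => f x - mollify φ t f x) - l2norm (mollify φ t f))]
  have e : (K * δ * energy b f) ^ 2 = K ^ 2 * (δ ^ 2 * energy b f ^ 2) := by ring
  rw [e] at h5
  linarith

end Nash

section Caccioppoli

variable {n m : ℕ} {v ζ : (Fin n → ℝ) → ℝ} {c : (Fin n → ℝ) → (Fin n → ℝ)}
  {b : Fin m → (Fin n → ℝ) → (Fin n → ℝ)} {x₀ : Fin n → ℝ} {s t : ℝ}

theorem exists_bound_deriv_smoothTransition :
    ∃ M, 0 ≤ M ∧ ∀ r, |deriv Real.smoothTransition r| ≤ M := by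
  have hc : Continuous (deriv Real.smoothTransition) :=
    (Real.smoothTransition.contDiff (n := 1)).continuous_deriv le_rfl
  have hs : HasCompactSupport (deriv Real.smoothTransition) := by
    refine HasCompactSupport.intro (K := Set.Icc 0 1) isCompact_Icc fun r hr => ?_
    rw [Set.mem_Icc, not_and_or, not_le, not_le] at hr
    rcases hr with hr | hr
    · have : Real.smoothTransition =ᶠ[𝓝 r] fun _ => 0 := by
        filter_upwards [eventually_lt_nhds hr] with y hy
        exact Real.smoothTransition.zero_of_nonpos hy.le
      rw [this.deriv_eq, deriv_const]
    · have : Real.smoothTransition =ᶠ[𝓝 r] fun _ => 1 := by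
        filter_upwards [eventually_gt_nhds hr] with y hy
        exact Real.smoothTransition.one_of_one_le hy.le
      rw [this.deriv_eq, deriv_const]
  obtain ⟨M, hM⟩ := hs.exists_bound_of_continuous hc
  exact ⟨M, (norm_nonneg _).trans (hM 0), hM⟩

/-- Squared Euclidean distance on `Fin n → ℝ`. -/
def sqDist (x₀ x : Fin n → ℝ) : ℝ := ∑ j, (x j - x₀ j) ^ 2

theorem contDiff_sqDist (x₀ : Fin n → ℝ) {k : ℕ∞} : ContDiff ℝ k (sqDist x₀) :=
  ContDiff.sum fun j _ => ((contDiff_apply ℝ ℝ j).sub contDiff_const).pow 2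

theorem continuous_sqDist (x₀ : Fin n → ℝ) : Continuous (sqDist x₀) :=
  (contDiff_sqDist x₀ (k := 0)).continuous

theorem mem_closedBall_of_sqDist_le {x : Fin n → ℝ} {ρ : ℝ} (hρ : 0 ≤ ρ)
    (h : sqDist x₀ x ≤ ρ ^ 2) : x ∈ Metric.closedBall x₀ ρ := by
  rw [Metric.mem_closedBall, dist_pi_le_iff hρ]
  intro j
  rw [Real.dist_eq]
  refine abs_le_of_sq_le_sq ((Finset.single_le_sum (f := fun j => (x j - x₀ j) ^ 2)
    (fun _ _ => sq_nonneg _) (Finset.mem_univ j)).trans h) hρ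

theorem isCompact_sqDist_le (x₀ : Fin n → ℝ) (t : ℝ) : IsCompact {x | sqDist x₀ x ≤ t} := by
  refine (isCompact_closedBall x₀ √t).of_isClosed_subset
    (isClosed_le (continuous_sqDist x₀) continuous_const) fun x hx => ?_
  refine mem_closedBall_of_sqDist_le (Real.sqrt_nonneg _) ?_
  rw [Real.sq_sqrt]
  · exact hx
  · exact (Finset.sum_nonneg fun _ _ => sq_nonneg _).trans hx

/-- Cutoff equal to `1` where `sqDist x₀ ≤ s` and to `0` where `t ≤ sqDist x₀`. -/
noncomputable def cutoff (x₀ : Fin n → ℝ) (s t : ℝ) (x : Fin n → ℝ) : ℝ :=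
  Real.smoothTransition ((t - sqDist x₀ x) / (t - s))

theorem cutoff_nonneg (x : Fin n → ℝ) : 0 ≤ cutoff x₀ s t x := Real.smoothTransition.nonneg _

theorem cutoff_le_one (x : Fin n → ℝ) : cutoff x₀ s t x ≤ 1 := Real.smoothTransition.le_one _

theorem cutoff_eq_one (hst : s < t) {x : Fin n → ℝ} (hx : sqDist x₀ x ≤ s) :
    cutoff x₀ s t x = 1 :=
  Real.smoothTransition.one_of_one_le ((one_le_div (by linarith)).2 (by linarith))

theorem cutoff_eq_zero (hst : s < t) {x : Fin n → ℝ} (hx : t ≤ sqDist x₀ x) :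
    cutoff x₀ s t x = 0 :=
  Real.smoothTransition.zero_of_nonpos
    (div_nonpos_of_nonpos_of_nonneg (by linarith) (by linarith))

theorem isTest_cutoff (hst : s < t) : IsTest ⊤ (cutoff x₀ s t) := by
  refine ⟨Real.smoothTransition.contDiff.comp
    ((contDiff_const.sub (contDiff_sqDist x₀)).div_const _), ?_⟩
  refine HasCompactSupport.intro (isCompact_sqDist_le x₀ t) fun x hx => ?_
  exact cutoff_eq_zero hst (not_le.1 hx).le

theorem xop_cutoff_eq_zero (hst : s < t) {x : Fin n → ℝ} (hx : t < sqDist x₀ x) :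
    Xop c (cutoff x₀ s t) x = 0 := by
  have : cutoff x₀ s t =ᶠ[𝓝 x] fun _ => 0 := by
    filter_upwards [(continuous_sqDist x₀).continuousAt.eventually (eventually_gt_nhds hx)]
      with y hy
    exact cutoff_eq_zero hst hy.le
  rw [Xop, this.fderiv_eq]
  simp

theorem exists_bound_xop_cutoff (hc : IsTest ⊤ c) (x₀ : Fin n → ℝ) :
    ∃ M, 0 ≤ M ∧ ∀ s t, s < t → ∀ x, |Xop c (cutoff x₀ s t) x| ≤ M / (t - s) := by
  obtain ⟨M, hM, bM⟩ := exists_bound_deriv_smoothTransition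
  have hq : IsTest 0 (Xop c (sqDist x₀)) := by
    refine ⟨((contDiff_sqDist x₀ (k := 1)).fderiv_right (m := 0) (by simp)).clm_apply
      (hc.mono le_top).smooth, hc.supp.mono fun x hx h0 => hx ?_⟩
    simp [Xop, h0]
  obtain ⟨Q, hQ, bQ⟩ := hq.bounded
  refine ⟨M * Q, mul_nonneg hM hQ, fun s t hst x => ?_⟩
  have hd : HasFDerivAt (fun x => (t - sqDist x₀ x) / (t - s))
      ((t - s)⁻¹ • (-fderiv ℝ (sqDist x₀) x)) x := by
    have h1 := (((contDiff_sqDist x₀ (k := 1)).differentiable (by simp) x).hasFDerivAt.const_sub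
      t).const_mul (t - s)⁻¹
    simpa only [div_eq_inv_mul] using h1
  have hσ : HasDerivAt Real.smoothTransition
      (deriv Real.smoothTransition ((t - sqDist x₀ x) / (t - s))) ((t - sqDist x₀ x) / (t - s)) :=
    ((Real.smoothTransition.contDiff (n := 1)).differentiable (by simp) _).hasDerivAt
  have h2 : fderiv ℝ (cutoff x₀ s t) x = _ := (hσ.comp_hasFDerivAt x hd).fderiv
  have hpos : 0 < t - s := by linarith
  rw [Xop, h2]
  simp only [FunLike.coe_smul, FunLike.coe_neg, Pi.smul_apply, Pi.neg_apply, smul_eq_mul]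
  rw [abs_mul, abs_mul, abs_neg, abs_of_pos (inv_pos.2 hpos)]
  have h3 : |fderiv ℝ (sqDist x₀) x (c x)| ≤ Q := bQ x
  calc _ ≤ M * ((t - s)⁻¹ * Q) := by gcongr; exact bM _
    _ = _ := by rw [div_eq_mul_inv]; ring

theorem sum_integral_xop_mul_sq_le (hb : ∀ i, IsTest ⊤ (b i)) (hζ : IsTest ⊤ ζ)
    (hdiv : ∀ i x, ζ x ≠ 0 → divergence (b i) x = 0) (hv : ContDiff ℝ 2 v)
    (hv0 : ∀ x, 0 ≤ v x) (hsub : ∀ x, ζ x ≠ 0 → 0 ≤ subLap b v x) :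
    ∑ i, ∫ x, Xop (b i) (fun y => ζ y * v y) x ^ 2 ≤
      ∑ i, ∫ x, v x ^ 2 * Xop (b i) ζ x ^ 2 := by
  have hbs : ∀ i, ContDiff ℝ 1 (b i) := fun i => ((hb i).mono le_top).smooth
  have hXv : ∀ i, ContDiff ℝ 1 (Xop (b i) v) := fun i =>
    (hv.fderiv_right (m := 1) (by norm_num)).clm_apply (hbs i)
  have hζ1 : IsTest 1 ζ := hζ.mono le_top
  have hv1 : ContDiff ℝ 1 v := hv.of_le (by norm_num)
  have hf : IsTest 1 (fun y => ζ y * v y) := hζ1.mul_left hv1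
  have hff : IsTest 1 (fun y => ζ y * (ζ y * v y)) := hζ1.mul_left hf.smooth
  have hF : ∀ i, IsTest 1 (fun y => ζ y * (ζ y * v y) * Xop (b i) v y) := fun i =>
    hff.mul_left (hXv i)
  have hF0 : ∀ i, ∫ x, Xop (b i) (fun y => ζ y * (ζ y * v y) * Xop (b i) v y) x = 0 := by
    intro i
    rw [integral_xop (hb i) le_top (hF i) le_rfl, neg_eq_zero]
    refine (integral_congr_ae (Eventually.of_forall fun x => ?_)).trans (integral_zero _ _)
    by_cases hx : ζ x = 0
    · simp [hx]
    · simp [hdiv i x hx]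
  have dζ := hζ1.differentiable le_rfl
  have dv := hv1.differentiable (by simp)
  have df := hf.differentiable le_rfl
  have dff := hff.differentiable le_rfl
  have pt : ∀ i x, Xop (b i) (fun y => ζ y * (ζ y * v y) * Xop (b i) v y) x =
      Xop (b i) (fun y => ζ y * v y) x ^ 2 - v x ^ 2 * Xop (b i) ζ x ^ 2 +
        ζ x * (ζ x * v x) * Xop (b i) (Xop (b i) v) x := by
    intro i x
    rw [xop_mul (dff x) ((hXv i).differentiable (by simp) x), xop_mul (dζ x) (df x),
      xop_mul (dζ x) (dv x)]
    ring
  have i1 : ∀ i, IsTest 0 (fun x => Xop (b i) (fun y => ζ y * v y) x ^ 2) := fun i =>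
    (hf.xop (l := 0) (by simp) ((hbs i).of_le (by simp))).sq
  have i2 : ∀ i, IsTest 0 (fun x => v x ^ 2 * Xop (b i) ζ x ^ 2) := fun i =>
    (hζ1.xop (l := 0) (by simp) ((hbs i).of_le (by simp))).sq.mul_right
      (contDiff_zero.2 (hv1.continuous.pow 2))
  have i3 : ∀ i, IsTest 0 (Xop (b i) (fun y => ζ y * (ζ y * v y) * Xop (b i) v y)) := fun i =>
    (hF i).xop (l := 0) (by simp) ((hbs i).of_le (by simp))
  have e : ∑ i, ∫ x, Xop (b i) (fun y => ζ y * (ζ y * v y) * Xop (b i) v y) x = 0 := by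
    simp [hF0]
  rw [← sub_nonpos, ← e, ← integral_finsetSum _ fun i _ => (i1 i).integrable,
    ← integral_finsetSum _ fun i _ => (i2 i).integrable,
    ← integral_finsetSum _ fun i _ => (i3 i).integrable,
    ← integral_sub (integrable_finsetSum _ fun i _ => (i1 i).integrable)
      (integrable_finsetSum _ fun i _ => (i2 i).integrable)]
  refine integral_mono ((integrable_finsetSum _ fun i _ => (i1 i).integrable).sub
      (integrable_finsetSum _ fun i _ => (i2 i).integrable))
      (integrable_finsetSum _ fun i _ => (i3 i).integrable) fun x => ?_
  simp only [pt, Finset.sum_add_distrib, Finset.sum_sub_distrib, ← Finset.mul_sum]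
  refine le_add_of_nonneg_right ?_
  by_cases hx : ζ x = 0
  · simp [hx]
  · have := hsub x hx
    rw [subLap] at this
    rw [← mul_assoc]
    exact mul_nonneg (mul_nonneg (mul_self_nonneg _) (hv0 x)) this

end Caccioppoli

section ReverseHolder

variable {n m : ℕ} {v w : (Fin n → ℝ) → ℝ} {b : Fin m → (Fin n → ℝ) → (Fin n → ℝ)}
  {x₀ : Fin n → ℝ} {s t : ℝ}

theorem integral_le_setIntegral {S : Set (Fin n → ℝ)} (hS : IsCompact S)
    {g h : (Fin n → ℝ) → ℝ} (hh : Continuous h) (g0 : ∀ x, 0 ≤ g x)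
    (h1 : ∀ x ∈ S, g x ≤ h x) (h2 : ∀ x, x ∉ S → g x = 0) : ∫ x, g x ≤ ∫ x in S, h x := by
  rw [← integral_indicator hS.measurableSet]
  refine integral_mono_of_nonneg (Eventually.of_forall g0)
    ((hh.continuousOn.integrableOn_compact hS).integrable_indicator hS.measurableSet)
    (Eventually.of_forall fun x => ?_)
  by_cases hx : x ∈ S
  · simpa [hx] using h1 x hx
  · simp [hx, h2 x hx]

theorem energy_sq_le (b : Fin m → (Fin n → ℝ) → (Fin n → ℝ)) (f : (Fin n → ℝ) → ℝ) :
    energy b f ^ 2 ≤ 2 * (∫ x, f x ^ 2) + 2 * m * ∑ i, ∫ x, Xop (b i) f x ^ 2 := by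
  have h1 : (∑ i, l2norm (Xop (b i) f)) ^ 2 ≤ m * ∑ i, l2norm (Xop (b i) f) ^ 2 := by
    simpa using sq_sum_le_card_mul_sum_sq (s := Finset.univ) (f := fun i => l2norm (Xop (b i) f))
  simp only [← l2norm_sq]
  rw [energy]
  nlinarith [sq_nonneg (l2norm f - ∑ i, l2norm (Xop (b i) f))]

theorem exists_interpolation (hb : ∀ i, IsTest ⊤ (b i))
    (hspan : Submodule.span ℝ {v : Fin n → ℝ | ∃ c, LieGen b c ∧ c x₀ = v} = ⊤)
    {R : ℝ} (hR : 0 < R) (hdiv : ∀ i, ∀ x ∈ Metric.closedBall x₀ R, divergence (b i) x = 0) :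
    ∃ T : ℝ, 0 < T ∧ T ≤ 1 ∧ T ≤ R ^ 2 ∧ ∃ δ₀ : ℝ, 0 < δ₀ ∧ δ₀ ≤ 1 ∧ ∃ K, 0 ≤ K ∧ ∃ N : ℕ,
      ∀ v, ContDiff ℝ 2 v → (∀ x, 0 ≤ v x) →
        (∀ x ∈ Metric.closedBall x₀ R, 0 ≤ subLap b v x) →
        ∀ s t δ, 0 ≤ s → s < t → t ≤ T → 0 < δ → δ ≤ δ₀ →
          ∫ x in {x | sqDist x₀ x ≤ s}, v x ^ 2 ≤
            K * ((δ / (t - s)) ^ 2 * (∫ x in {x | sqDist x₀ x ≤ t}, v x ^ 2) +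
              (δ ^ N)⁻¹ * (∫ x in {x | sqDist x₀ x ≤ t}, v x) ^ 2) := by
  obtain ⟨ρ, hρ, δ₀, hδ₀, hδ₁, K, hK, N, hnash⟩ := exists_nash hb hspan
  choose M hM bM using fun i => exists_bound_xop_cutoff (hb i) x₀
  set L : ℝ := 2 + 2 * m * ∑ i, M i ^ 2 with hL
  have hS : 0 ≤ ∑ i, M i ^ 2 := Finset.sum_nonneg fun i _ => sq_nonneg _
  have hL1 : 1 ≤ L := by
    have : 0 ≤ 2 * (m : ℝ) * ∑ i, M i ^ 2 := by positivity
    linarith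
  refine ⟨min (min 1 (R ^ 2)) (ρ ^ 2), by positivity, (min_le_left _ _).trans (min_le_left _ _),
    (min_le_left _ _).trans (min_le_right _ _), δ₀, hδ₀, hδ₁, K * L, by positivity, N,
    fun v hv hv0 hsub s t δ hs hst htT hδ hδδ => ?_⟩
  have ht1 : t ≤ 1 := htT.trans ((min_le_left _ _).trans (min_le_left _ _))
  have htR : t ≤ R ^ 2 := htT.trans ((min_le_left _ _).trans (min_le_right _ _))
  have htρ : t ≤ ρ ^ 2 := htT.trans (min_le_right _ _)
  have hd : 0 < t - s := by linarith
  set ζ := cutoff x₀ s t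
  have hζ : IsTest ⊤ ζ := isTest_cutoff hst
  have hζt : ∀ x, ζ x ≠ 0 → sqDist x₀ x < t := fun x hx =>
    not_le.1 fun h => hx (cutoff_eq_zero hst h)
  have hζR : ∀ x, ζ x ≠ 0 → x ∈ Metric.closedBall x₀ R := fun x hx =>
    mem_closedBall_of_sqDist_le hR.le ((hζt x hx).le.trans htR)
  have hf : IsTest 2 (fun y => ζ y * v y) := (hζ.mono le_top).mul_left hv
  have hcac := sum_integral_xop_mul_sq_le hb hζ (fun i x hx => hdiv i x (hζR x hx)) hv hv0
    fun x hx => hsub x (hζR x hx)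
  have hn := hnash _ hf (fun x hx => mem_closedBall_of_sqDist_le hρ.le
    ((hζt x (left_ne_zero_of_mul hx)).le.trans htρ)) δ hδ hδδ
  set A := ∫ x in {x | sqDist x₀ x ≤ t}, v x ^ 2 with hA
  have hA0 : 0 ≤ A := integral_nonneg fun _ => sq_nonneg _
  have hCt := isCompact_sqDist_le x₀ t
  have b1 : ∫ x in {x | sqDist x₀ x ≤ s}, v x ^ 2 ≤ ∫ x, (ζ x * v x) ^ 2 := by
    have hCs := isCompact_sqDist_le x₀ s
    rw [setIntegral_congr_fun (g := fun x => (ζ x * v x) ^ 2) hCs.measurableSet fun x hx => by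
      simp only [ζ, cutoff_eq_one hst hx, one_mul]]
    exact setIntegral_le_integral hf.sq.integrable (Eventually.of_forall fun _ => sq_nonneg _)
  have b2 : ∫ x, (ζ x * v x) ^ 2 ≤ A := by
    refine integral_le_setIntegral hCt (hv.continuous.pow 2) (fun _ => sq_nonneg _)
      (fun x _ => ?_) fun x hx => ?_
    · rw [mul_pow]
      exact mul_le_of_le_one_left (sq_nonneg _) (pow_le_one₀ (cutoff_nonneg x) (cutoff_le_one x))
    · simp [ζ, cutoff_eq_zero hst (not_le.1 hx).le]
  have b3 : ∫ x, |ζ x * v x| ≤ ∫ x in {x | sqDist x₀ x ≤ t}, v x := by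
    refine integral_le_setIntegral hCt hv.continuous (fun _ => abs_nonneg _)
      (fun x _ => ?_) fun x hx => ?_
    · rw [abs_of_nonneg (mul_nonneg (cutoff_nonneg x) (hv0 x))]
      exact mul_le_of_le_one_left (hv0 x) (cutoff_le_one x)
    · simp [ζ, cutoff_eq_zero hst (not_le.1 hx).le]
  have b4 : ∀ i, ∫ x, v x ^ 2 * Xop (b i) ζ x ^ 2 ≤ (M i / (t - s)) ^ 2 * A := by
    intro i
    rw [hA, ← integral_const_mul]
    refine integral_le_setIntegral hCt (continuous_const.mul (hv.continuous.pow 2))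
      (fun _ => by positivity) (fun x _ => ?_) fun x hx => ?_
    · rw [mul_comm]
      refine mul_le_mul_of_nonneg_right ?_ (sq_nonneg _)
      rw [← sq_abs (Xop _ _ _)]
      exact pow_le_pow_left₀ (abs_nonneg _) (bM i s t hst x) 2
    · simp [ζ, xop_cutoff_eq_zero hst (not_le.1 hx)]
  have b5 : ∑ i, ∫ x, Xop (b i) (fun y => ζ y * v y) x ^ 2 ≤
      ((t - s)⁻¹) ^ 2 * (∑ i, M i ^ 2) * A := by
    refine hcac.trans ((Finset.sum_le_sum fun i _ => b4 i).trans (le_of_eq ?_))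
    rw [Finset.mul_sum, Finset.sum_mul]
    refine Finset.sum_congr rfl fun i _ => ?_
    rw [div_eq_mul_inv]; ring
  have hinv : 1 ≤ ((t - s)⁻¹) ^ 2 := one_le_pow₀ ((one_le_inv₀ hd).2 (by linarith))
  have b6 : energy b (fun y => ζ y * v y) ^ 2 ≤ ((t - s)⁻¹) ^ 2 * L * A := by
    refine (energy_sq_le b _).trans ?_
    have h1 := mul_le_mul_of_nonneg_left b5 (show (0 : ℝ) ≤ 2 * m by positivity)
    have h2 := mul_le_mul_of_nonneg_right hinv hA0
    rw [hL]
    linarith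
  have hI : 0 ≤ ∫ x, |ζ x * v x| := integral_nonneg fun _ => abs_nonneg _
  have b7 := pow_le_pow_left₀ hI b3 2
  refine b1.trans (hn.trans ?_)
  rw [mul_assoc]
  refine mul_le_mul_of_nonneg_left ?_ hK
  rw [mul_add]
  refine add_le_add ?_ ?_
  · refine (mul_le_mul_of_nonneg_left b6 (sq_nonneg δ)).trans (le_of_eq ?_)
    rw [div_eq_mul_inv]; ring
  · refine (mul_le_mul_of_nonneg_left b7 (by positivity)).trans ?_
    exact le_mul_of_one_le_left (by positivity) hL1

/-- Iterative absorption of the quadratic term over shrinking neighbourhoods. -/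
theorem le_of_forall_le_absorb {A : ℝ → ℝ} {a B : ℝ} {N : ℕ} (ht : t ≤ 1) (hA : Monotone A)
    (hA0 : ∀ s, 0 ≤ A s) (ha : 0 ≤ a) (hB : 0 ≤ B)
    (h : ∀ s s', 0 ≤ s → s < s' → s' ≤ t →
      A s ≤ (1 / 2) ^ (N + 1) * A s' + a * ((s' - s) ^ N)⁻¹ * B)
    (hs : 0 ≤ s) (hst : s < t) :
    A s ≤ 2 ^ (N + 1) * a * ((t - s) ^ N)⁻¹ * B := by
  set D := 2 ^ N * a * B with hD
  have hD0 : 0 ≤ D := by positivity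
  have iter : ∀ k : ℕ, ∀ s, 0 ≤ s → s < t → (t - s) ^ N * A s ≤ (1 / 2) ^ k * A t + 2 * D := by
    intro k
    induction k with
    | zero =>
      intro s hs hst
      have h1 : (t - s) ^ N ≤ 1 := pow_le_one₀ (by linarith) (by linarith)
      have h2 := mul_le_of_le_one_left (hA0 s) h1
      have h3 := hA hst.le
      rw [pow_zero]
      linarith
    | succ k ih =>
      intro s hs hst
      have h1 := h s ((s + t) / 2) hs (by linarith) (by linarith)
      have h2 := ih ((s + t) / 2) (by linarith) (by linarith)
      have e1 : t - (s + t) / 2 = (t - s) / 2 := by ring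
      have e2 : (s + t) / 2 - s = (t - s) / 2 := by ring
      have hp : 0 < (t - s) ^ N := pow_pos (by linarith) N
      rw [e1] at h2
      rw [e2] at h1
      have h3 := mul_le_mul_of_nonneg_left h1 hp.le
      have e3 : (t - s) ^ N * ((1 / 2) ^ (N + 1) * A ((s + t) / 2) +
          a * (((t - s) / 2) ^ N)⁻¹ * B) =
          (1 / 2) * (((t - s) / 2) ^ N * A ((s + t) / 2)) + D := by
        rw [hD, div_pow, div_pow, one_pow, pow_succ]
        field_simp
      rw [e3] at h3
      rw [pow_succ]
      linarith
  have h0 : (t - s) ^ N * A s ≤ 2 * D := by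
    refine ge_of_tendsto' (x := atTop) (f := fun k : ℕ => (1 / 2 : ℝ) ^ k * A t + 2 * D) ?_
      fun k => iter k s hs hst
    have := ((tendsto_pow_atTop_nhds_zero_of_lt_one (r := (1 / 2 : ℝ)) (by norm_num)
      (by norm_num)).mul_const (A t)).add_const (2 * D)
    simpa using this
  have hp : 0 < (t - s) ^ N := pow_pos (by linarith) N
  rw [← le_div_iff₀' hp] at h0
  refine h0.trans (le_of_eq ?_)
  rw [hD, div_eq_mul_inv]; ring

theorem setIntegral_sqDist_mono (hv : Continuous v) (hv0 : ∀ x, 0 ≤ v x) (hst : s ≤ t) :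
    ∫ x in {x | sqDist x₀ x ≤ s}, v x ≤ ∫ x in {x | sqDist x₀ x ≤ t}, v x :=
  setIntegral_mono_set (hv.continuousOn.integrableOn_compact (isCompact_sqDist_le x₀ t))
    (Eventually.of_forall hv0)
    (Eventually.of_forall fun _ hx => le_trans hx hst)

/-- A local reverse Hölder inequality for nonnegative subsolutions. -/
theorem exists_reverse_holder (hb : ∀ i, IsTest ⊤ (b i))
    (hspan : Submodule.span ℝ {v : Fin n → ℝ | ∃ c, LieGen b c ∧ c x₀ = v} = ⊤)
    {R : ℝ} (hR : 0 < R) (hdiv : ∀ i, ∀ x ∈ Metric.closedBall x₀ R, divergence (b i) x = 0) :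
    ∃ T : ℝ, 0 < T ∧ T ≤ R ^ 2 ∧ ∃ K, 0 ≤ K ∧ ∃ N : ℕ,
      ∀ v, ContDiff ℝ 2 v → (∀ x, 0 ≤ v x) →
        (∀ x ∈ Metric.closedBall x₀ R, 0 ≤ subLap b v x) →
        ∀ s t, 0 ≤ s → s < t → t ≤ T →
          ∫ x in {x | sqDist x₀ x ≤ s}, v x ^ 2 ≤
            K * ((t - s) ^ N)⁻¹ * (∫ x in {x | sqDist x₀ x ≤ t}, v x) ^ 2 := by
  obtain ⟨T, hT, hT1, hTR, δ₀, hδ₀, hδ₁, K, hK, N, h_int⟩ := exists_interpolation hb hspan hR hdiv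
  obtain ⟨c, hc, hcδ, hcK⟩ : ∃ c : ℝ, 0 < c ∧ c ≤ δ₀ ∧ K * c ^ 2 ≤ (1 / 2) ^ (N + 1) := by
    have h1 : ∀ᶠ c : ℝ in 𝓝[>] 0, c ≤ δ₀ := nhdsWithin_le_nhds (eventually_le_nhds hδ₀)
    have h2 : Tendsto (fun c : ℝ => K * c ^ 2) (𝓝 0) (𝓝 (K * 0 ^ 2)) := by
      have : Continuous fun c : ℝ => K * c ^ 2 := by fun_prop
      exact this.continuousAt
    have h3 : ∀ᶠ c : ℝ in 𝓝[>] 0, K * c ^ 2 ≤ (1 / 2) ^ (N + 1) :=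
      nhdsWithin_le_nhds (h2.eventually_le_const (by norm_num))
    obtain ⟨c, h⟩ := (eventually_mem_nhdsWithin.and (h1.and h3)).exists
    exact ⟨c, h⟩
  refine ⟨T, hT, hTR, 2 ^ (N + 1) * (K * (c ^ N)⁻¹), by positivity, N,
    fun v hv hv0 hsub s t hs hst htT => ?_⟩
  have hv2 : Continuous fun x => v x ^ 2 := hv.continuous.pow 2
  refine le_of_forall_le_absorb (A := fun s => ∫ x in {x | sqDist x₀ x ≤ s}, v x ^ 2)
    (htT.trans hT1)
    (fun s t hst => setIntegral_sqDist_mono hv2 (fun _ => sq_nonneg _) hst)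
    (fun s => integral_nonneg fun _ => sq_nonneg _) (by positivity) (sq_nonneg _)
    (fun s s' hs hss hst => ?_) hs hst
  have hd : 0 < s' - s := by linarith
  have hA0 : 0 ≤ ∫ x in {x | sqDist x₀ x ≤ s'}, v x ^ 2 := integral_nonneg fun _ => sq_nonneg _
  have h1 := h_int v hv hv0 hsub s s' (c * (s' - s)) hs hss (hst.trans htT) (by positivity)
    ((mul_le_of_le_one_right hc.le (by linarith)).trans hcδ)
  have h2 := pow_le_pow_left₀ (integral_nonneg fun x => hv0 x)
    (setIntegral_sqDist_mono (x₀ := x₀) hv.continuous hv0 hst) 2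
  rw [mul_div_cancel_right₀ _ hd.ne', mul_add, ← mul_assoc] at h1
  refine h1.trans (add_le_add (mul_le_mul_of_nonneg_right hcK hA0) ?_)
  rw [mul_pow, mul_inv]
  have := mul_le_mul_of_nonneg_left h2
    (show 0 ≤ K * ((c ^ N)⁻¹ * ((s' - s) ^ N)⁻¹) by positivity)
  linarith

theorem subLap_sq_nonneg (hb : ∀ i, IsTest ⊤ (b i)) (hv : ContDiff ℝ 2 v) {x : Fin n → ℝ}
    (hvx : 0 ≤ v x) (h : 0 ≤ subLap b v x) : 0 ≤ subLap b (fun y => v y ^ 2) x := by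
  have dv : Differentiable ℝ v := hv.differentiable (by norm_num)
  have hXv : ∀ i, Differentiable ℝ (Xop (b i) v) := fun i =>
    ((hv.fderiv_right (m := 1) (by norm_num)).clm_apply
      ((hb i).mono le_top).smooth).differentiable (by simp)
  have e1 : ∀ i, Xop (b i) (fun y => v y ^ 2) = fun y => v y * (2 * Xop (b i) v y) := fun i => by
    ext y
    simp only [pow_two]
    rw [xop_mul (dv y) (dv y)]; ring
  have e2 : ∀ i, Xop (b i) (fun y => v y * (2 * Xop (b i) v y)) x =
      2 * (v x * Xop (b i) (Xop (b i) v) x) + 2 * Xop (b i) v x ^ 2 := fun i => by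
    rw [xop_mul (dv x) ((hXv i x).const_mul 2)]
    have : Xop (b i) (fun y => 2 * Xop (b i) v y) x = 2 * Xop (b i) (Xop (b i) v) x := by
      have := fderiv_const_mul (hXv i x) (2 : ℝ)
      rw [Xop, this]; simp [Xop]
    rw [this]; ring
  simp only [subLap, e1, e2, Finset.sum_add_distrib, ← Finset.mul_sum]
  rw [subLap] at h
  have : 0 ≤ ∑ i, Xop (b i) v x ^ 2 := Finset.sum_nonneg fun _ _ => sq_nonneg _
  have := mul_nonneg hvx h
  linarith

theorem subLap_pow_nonneg (hb : ∀ i, IsTest ⊤ (b i)) (hv : ContDiff ℝ 2 v) {x : Fin n → ℝ}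
    (hvx : 0 ≤ v x) (h : 0 ≤ subLap b v x) (k : ℕ) : 0 ≤ subLap b (fun y => v y ^ 2 ^ k) x := by
  induction k with
  | zero => simpa using h
  | succ k ih =>
    have := subLap_sq_nonneg hb (hv.pow (2 ^ k)) (pow_nonneg hvx _) ih
    simpa only [← pow_mul, ← pow_succ] using this

end ReverseHolder

section Moser

variable {n m : ℕ} {v w : (Fin n → ℝ) → ℝ} {b : Fin m → (Fin n → ℝ) → (Fin n → ℝ)}
  {x₀ : Fin n → ℝ}

theorem le_pow_two_pow_of_recursion {I : ℕ → ℝ} {a β : ℝ} (ha : 1 ≤ a) (hβ : 1 ≤ β)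
    (hI : ∀ k, 0 ≤ I k) (h : ∀ k, I (k + 1) ≤ a * β ^ k * I k ^ 2) (k : ℕ) :
    I k ≤ (a * β * I 0) ^ 2 ^ k := by
  have key : ∀ k, a * β ^ (k + 1) * I k ≤ (a * β * I 0) ^ 2 ^ k := by
    intro k
    induction k with
    | zero => simp
    | succ k ih =>
      have h1 := mul_le_mul_of_nonneg_left (h k) (show 0 ≤ a * β ^ (k + 1 + 1) by positivity)
      have h0 : 0 ≤ a * β ^ (k + 1) * I k := mul_nonneg (by positivity) (hI k)
      have h2 := pow_le_pow_left₀ h0 ih 2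
      rw [← pow_mul, ← pow_succ] at h2
      refine h1.trans (le_trans (le_of_eq ?_) h2)
      ring
  refine le_trans ?_ (key k)
  exact le_mul_of_one_le_left (hI k) (one_le_mul_of_one_le_of_one_le ha (one_le_pow₀ hβ))

/-- A function whose dyadic power means over a neighbourhood are bounded by powers of `J` is
bounded by `J`. -/
theorem le_of_setIntegral_pow_le (hw : Continuous w) (hw0 : ∀ x, 0 ≤ w x) {J : ℝ} (hJ : 0 ≤ J)
    {S : ℕ → Set (Fin n → ℝ)} {U : Set (Fin n → ℝ)} (hU : IsOpen U) (hS : ∀ k, IsCompact (S k))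
    (hUS : ∀ k, U ⊆ S k) (h : ∀ k, ∫ x in S k, w x ^ 2 ^ k ≤ J ^ 2 ^ k) {x : Fin n → ℝ}
    (hx : x ∈ U) : w x ≤ J := by
  by_contra! hlt
  obtain ⟨J', hJJ, hJw⟩ := exists_between hlt
  set V := U ∩ {y | J' < w y} with hV
  have hVo : IsOpen V := hU.inter (isOpen_lt continuous_const hw)
  have hVS : ∀ k, V ⊆ S k := fun k => Set.inter_subset_left.trans (hUS k)
  have hVfin : volume V ≠ ⊤ := (measure_mono (hVS 0)).trans_lt (hS 0).measure_lt_top |>.ne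
  have hVpos : 0 < volume.real V :=
    ENNReal.toReal_pos (hVo.measure_pos volume ⟨x, hx, hJw⟩).ne' hVfin
  have hJ' : 0 < J' := hJ.trans_lt hJJ
  have bound : ∀ k : ℕ, volume.real V ≤ (J / J') ^ 2 ^ k := by
    intro k
    rw [div_pow, le_div_iff₀ (by positivity)]
    refine le_trans ?_ (h k)
    have h_int : IntegrableOn (fun x => w x ^ 2 ^ k) (S k) :=
      (hw.pow _).continuousOn.integrableOn_compact (hS k)
    calc volume.real V * J' ^ 2 ^ k = ∫ _ in V, J' ^ 2 ^ k := by simp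
      _ ≤ ∫ x in V, w x ^ 2 ^ k :=
        setIntegral_mono_on (integrableOn_const hVfin) (h_int.mono_set (hVS k))
          hVo.measurableSet fun y hy => pow_le_pow_left₀ hJ'.le (le_of_lt hy.2) _
      _ ≤ ∫ x in S k, w x ^ 2 ^ k :=
        setIntegral_mono_set h_int (Eventually.of_forall fun _ => pow_nonneg (hw0 _) _)
          (Eventually.of_forall (hVS k))
  have hlim : Tendsto (fun k : ℕ => (J / J') ^ 2 ^ k) atTop (𝓝 0) :=
    (tendsto_pow_atTop_nhds_zero_of_lt_one (by positivity) ((div_lt_one hJ').2 hJJ)).comp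
      (tendsto_pow_atTop_atTop_of_one_lt one_lt_two)
  exact absurd (ge_of_tendsto' hlim bound) (not_le.2 hVpos)

/-- Moser iteration: nonnegative subsolutions are locally bounded by their integral. -/
theorem exists_local_bound (hb : ∀ i, IsTest ⊤ (b i))
    (hspan : Submodule.span ℝ {v : Fin n → ℝ | ∃ c, LieGen b c ∧ c x₀ = v} = ⊤)
    {R : ℝ} (hR : 0 < R) (hdiv : ∀ i, ∀ x ∈ Metric.closedBall x₀ R, divergence (b i) x = 0) :
    ∃ U : Set (Fin n → ℝ), IsOpen U ∧ x₀ ∈ U ∧ ∃ C, 0 ≤ C ∧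
      ∀ w, ContDiff ℝ 2 w → (∀ x, 0 ≤ w x) →
        (∀ x ∈ Metric.closedBall x₀ R, 0 ≤ subLap b w x) →
        ∀ x ∈ U, w x ≤ C * ∫ y in Metric.closedBall x₀ R, w y := by
  obtain ⟨T, hT, hTR, K, hK, N, hrev⟩ := exists_reverse_holder hb hspan hR hdiv
  have hUo : IsOpen {x | sqDist x₀ x < T / 2} :=
    isOpen_lt (continuous_sqDist x₀) continuous_const
  set a := max 1 (K * (4 / T) ^ N) with ha
  refine ⟨{x | sqDist x₀ x < T / 2}, hUo, by simpa [sqDist] using hT, a * 2 ^ N, by positivity,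
    fun w hw hw0 hsub x hx => ?_⟩
  let τ : ℕ → ℝ := fun k => T / 2 + T * (1 / 2) ^ (k + 1)
  have hτs : ∀ k, τ k - τ (k + 1) = T / 4 * (1 / 2) ^ k := fun k => by
    simp only [τ, pow_succ]; ring
  have hτ0 : ∀ k, T / 2 ≤ τ k := fun k => by
    have : 0 ≤ T * (1 / 2) ^ (k + 1) := by positivity
    simp only [τ]; linarith
  have hτT : ∀ k, τ k ≤ T := fun k => by
    have : ((1 / 2 : ℝ)) ^ (k + 1) ≤ 1 / 2 := by
      rw [pow_succ]
      exact mul_le_of_le_one_left (by norm_num) (pow_le_one₀ (by norm_num) (by norm_num))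
    have := mul_le_mul_of_nonneg_left this hT.le
    simp only [τ]; linarith
  have hrec : ∀ k, ∫ x in {x | sqDist x₀ x ≤ τ (k + 1)}, w x ^ 2 ^ (k + 1) ≤
      a * (2 ^ N) ^ k * (∫ x in {x | sqDist x₀ x ≤ τ k}, w x ^ 2 ^ k) ^ 2 := by
    intro k
    have hpos : 0 < τ k - τ (k + 1) := by rw [hτs]; positivity
    have h1 := hrev (fun y => w y ^ 2 ^ k) (hw.pow _) (fun y => pow_nonneg (hw0 y) _)
      (fun y hy => subLap_pow_nonneg hb hw (hw0 y) (hsub y hy) k) (τ (k + 1)) (τ k)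
      ((half_pos hT).le.trans (hτ0 _)) (by linarith) (hτT k)
    simp only [← pow_mul, ← pow_succ] at h1
    refine h1.trans (mul_le_mul_of_nonneg_right ?_ (sq_nonneg _))
    rw [hτs]
    have e : K * ((T / 4 * (1 / 2) ^ k) ^ N)⁻¹ = K * (4 / T) ^ N * (2 ^ N) ^ k := by
      rw [mul_pow, mul_inv, ← inv_pow, inv_div, ← pow_mul, ← pow_mul, mul_comm N k, one_div,
        inv_pow, inv_inv]
      ring
    rw [e]
    exact mul_le_mul_of_nonneg_right (le_max_right _ _) (by positivity)
  have hmos := le_pow_two_pow_of_recursion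
    (I := fun k => ∫ x in {x | sqDist x₀ x ≤ τ k}, w x ^ 2 ^ k) (le_max_left _ _)
    (one_le_pow₀ one_le_two)
    (fun k => integral_nonneg fun x => pow_nonneg (hw0 x) _) hrec
  have h0 : ∫ x in {x | sqDist x₀ x ≤ τ 0}, w x ^ 2 ^ 0 ≤ ∫ y in Metric.closedBall x₀ R, w y := by
    simp only [pow_zero, pow_one]
    exact setIntegral_mono_set
      (hw.continuous.continuousOn.integrableOn_compact (isCompact_closedBall x₀ R))
      (Eventually.of_forall hw0) (Eventually.of_forall fun y hy =>
        mem_closedBall_of_sqDist_le hR.le (le_trans hy ((hτT 0).trans hTR)))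
  have hJ : 0 ≤ ∫ x in {x | sqDist x₀ x ≤ τ 0}, w x ^ 2 ^ 0 :=
    integral_nonneg fun x => pow_nonneg (hw0 x) _
  refine (le_of_setIntegral_pow_le hw.continuous hw0 (by positivity) hUo
    (fun k => isCompact_sqDist_le x₀ (τ k)) (fun k y hy => (le_of_lt hy).trans (hτ0 k)) hmos
    hx).trans ?_
  exact mul_le_mul_of_nonneg_left h0 (by positivity)

end Moser

section Localization

variable {n m : ℕ} {u v w χ : (Fin n → ℝ) → ℝ} {b b' : Fin m → (Fin n → ℝ) → (Fin n → ℝ)}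
  {c c' d d' : (Fin n → ℝ) → (Fin n → ℝ)} {x x₀ : Fin n → ℝ} {Ω : Set (Fin n → ℝ)}

theorem isTest_smul_of_contDiffOn {F : Type*} [NormedAddCommGroup F] [NormedSpace ℝ F]
    {k : ℕ∞} {g : (Fin n → ℝ) → F} (hΩ : IsOpen Ω) (hχ : IsTest k χ) (hχΩ : tsupport χ ⊆ Ω)
    (hg : ContDiffOn ℝ k g Ω) : IsTest k (fun x => χ x • g x) := by
  refine ⟨contDiff_iff_contDiffAt.2 fun x => ?_, hχ.supp.smul_right⟩
  by_cases hx : x ∈ Ω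
  · exact hχ.smooth.contDiffAt.smul (hg.contDiffAt (hΩ.mem_nhds hx))
  · have : (fun x => χ x • g x) =ᶠ[𝓝 x] fun _ => 0 := by
      filter_upwards [(isClosed_tsupport χ).isOpen_compl.mem_nhds fun h => hx (hχΩ h)] with y hy
      rw [image_eq_zero_of_notMem_tsupport hy, zero_smul]
    exact contDiffAt_const.congr_of_eventuallyEq this

theorem Filter.EventuallyEq.coord (h : c =ᶠ[𝓝 x] c') (j : Fin n) :
    (fun y => c y j) =ᶠ[𝓝 x] fun y => c' y j := by
  filter_upwards [h] with y hy
  rw [hy]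

theorem Filter.EventuallyEq.vfBracket (hc : c =ᶠ[𝓝 x] c') (hd : d =ᶠ[𝓝 x] d') :
    vfBracket c d =ᶠ[𝓝 x] vfBracket c' d' := by
  filter_upwards [hc.eventuallyEq_nhds, hd.eventuallyEq_nhds] with y hcy hdy
  ext l
  simp only [_root_.vfBracket]
  rw [(hcy.coord l).fderiv_eq, (hdy.coord l).fderiv_eq, hcy.eq_of_nhds, hdy.eq_of_nhds]

theorem Filter.EventuallyEq.xop (hc : c =ᶠ[𝓝 x] c') (hu : u =ᶠ[𝓝 x] v) :
    Xop c u =ᶠ[𝓝 x] Xop c' v := by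
  filter_upwards [hc, hu.eventuallyEq_nhds] with y hcy huy
  rw [Xop, Xop, huy.fderiv_eq, hcy]

theorem subLap_congr (hb : ∀ i, b i =ᶠ[𝓝 x] b' i) (hu : u =ᶠ[𝓝 x] v) :
    subLap b u x = subLap b' v x :=
  Finset.sum_congr rfl fun i _ => ((hb i).xop ((hb i).xop hu)).eq_of_nhds

theorem divergence_congr (hc : c =ᶠ[𝓝 x] c') : divergence c x = divergence c' x :=
  Finset.sum_congr rfl fun j _ => by rw [(hc.coord j).fderiv_eq]

theorem LieGen.exists_eventuallyEq (hb : ∀ i, b' i =ᶠ[𝓝 x] b i) (hc : LieGen b c) :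
    ∃ c', LieGen b' c' ∧ c' =ᶠ[𝓝 x] c := by
  induction hc with
  | base i => exact ⟨_, LieGen.base i, hb i⟩
  | bracket _ _ ihc ihd =>
    obtain ⟨c', hc', ec⟩ := ihc
    obtain ⟨d', hd', ed⟩ := ihd
    exact ⟨_, hc'.bracket hd', ec.vfBracket ed⟩

theorem span_lieGen_eq_top (hb : ∀ i, b' i =ᶠ[𝓝 x] b i)
    (h : Submodule.span ℝ {v : Fin n → ℝ | ∃ c, LieGen b c ∧ c x = v} = ⊤) :
    Submodule.span ℝ {v : Fin n → ℝ | ∃ c, LieGen b' c ∧ c x = v} = ⊤ := by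
  refine top_unique (h.ge.trans (Submodule.span_mono ?_))
  rintro v ⟨c, hc, rfl⟩
  obtain ⟨c', hc', e⟩ := hc.exists_eventuallyEq hb
  exact ⟨c', hc', e.eq_of_nhds⟩

theorem xop_comp {F : ℝ → ℝ} {F' : ℝ} (hF : HasDerivAt F F' (u x)) (hu : DifferentiableAt ℝ u x) :
    Xop c (fun y => F (u y)) x = F' * Xop c u x := by
  have : fderiv ℝ (fun y => F (u y)) x = _ := (hF.comp_hasFDerivAt x hu.hasFDerivAt).fderiv
  rw [Xop, this]
  simp [Xop]

/-- Nondecreasing convex functions preserve subharmonicity. -/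
theorem subLap_comp_nonneg (hb : ∀ i, IsTest ⊤ (b i)) (hu : ContDiff ℝ 2 u) {F F' F'' : ℝ → ℝ}
    (hF : ∀ r, HasDerivAt F (F' r) r) (hF' : ∀ r, HasDerivAt F' (F'' r) r)
    (h1 : ∀ r, 0 ≤ F' r) (h2 : ∀ r, 0 ≤ F'' r) (h : 0 ≤ subLap b u x) :
    0 ≤ subLap b (fun y => F (u y)) x := by
  have du : Differentiable ℝ u := hu.differentiable (by norm_num)
  have hXu : ∀ i, Differentiable ℝ (Xop (b i) u) := fun i =>
    ((hu.fderiv_right (m := 1) (by norm_num)).clm_apply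
      ((hb i).mono le_top).smooth).differentiable (by simp)
  have e1 : ∀ i, Xop (b i) (fun y => F (u y)) = fun y => F' (u y) * Xop (b i) u y := fun i => by
    ext y; exact xop_comp (hF _) (du y)
  have e2 : ∀ i, Xop (b i) (fun y => F' (u y) * Xop (b i) u y) x =
      F' (u x) * Xop (b i) (Xop (b i) u) x + F'' (u x) * Xop (b i) u x ^ 2 := fun i => by
    rw [xop_mul (f := fun y => F' (u y)) ((hF' _).differentiableAt.comp x (du x)) (hXu i x),
      xop_comp (hF' _) (du x)]
    ring
  simp only [subLap, e1, e2, Finset.sum_add_distrib, ← Finset.mul_sum]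
  exact add_nonneg (mul_nonneg (h1 _) h)
    (mul_nonneg (h2 _) (Finset.sum_nonneg fun _ _ => sq_nonneg _))

theorem exists_smooth_convex_majorant {η : ℝ} (hη : 0 < η) :
    ∃ F F' F'' : ℝ → ℝ, ContDiff ℝ 2 F ∧ (∀ r, HasDerivAt F (F' r) r) ∧
      (∀ r, HasDerivAt F' (F'' r) r) ∧ (∀ r, 0 ≤ F' r) ∧ (∀ r, 0 ≤ F'' r) ∧
      (∀ r, 0 ≤ F r) ∧ (∀ r, r ≤ F r) ∧ ∀ r, F r ≤ 2 * |r| + η := by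
  have pos : ∀ r : ℝ, 0 < r ^ 2 + η ^ 2 := fun r => by positivity
  have hq : ∀ r, HasDerivAt (fun r : ℝ => √(r ^ 2 + η ^ 2)) (r / √(r ^ 2 + η ^ 2)) r := by
    intro r
    have := ((hasDerivAt_pow 2 r).add_const (η ^ 2)).sqrt (pos r).ne'
    convert this using 1
    simp [mul_div_mul_left]
  have habs : ∀ r, |r| ≤ √(r ^ 2 + η ^ 2) := fun r =>
    Real.abs_le_sqrt (by linarith [sq_nonneg η])
  have spos : ∀ r : ℝ, 0 < √(r ^ 2 + η ^ 2) := fun r => Real.sqrt_pos.2 (pos r)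
  refine ⟨fun r => r + √(r ^ 2 + η ^ 2), fun r => 1 + r / √(r ^ 2 + η ^ 2),
    fun r => (1 * √(r ^ 2 + η ^ 2) - r * (r / √(r ^ 2 + η ^ 2))) / √(r ^ 2 + η ^ 2) ^ 2,
    ?_, fun r => (hasDerivAt_id r).add (hq r), fun r => ?_, fun r => ?_, fun r => ?_,
    fun r => ?_, fun r => ?_, fun r => ?_⟩
  · exact contDiff_id.add (((contDiff_id.pow 2).add contDiff_const).sqrt fun r => (pos r).ne')
  · exact ((hasDerivAt_id r).div (hq r) (spos r).ne').const_add 1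
  · have := (abs_le.1 (habs r)).1
    rw [← neg_le_iff_add_nonneg', le_div_iff₀ (spos r)]
    linarith
  · refine div_nonneg ?_ (sq_nonneg _)
    rw [sub_nonneg, mul_div_assoc', div_le_iff₀ (spos r), one_mul, Real.mul_self_sqrt (pos r).le]
    nlinarith [sq_nonneg η]
  · have := (abs_le.1 (habs r)).1
    simp only
    linarith
  · simp only
    linarith [spos r]
  · have : √(r ^ 2 + η ^ 2) ≤ |r| + η := by
      refine Real.sqrt_le_iff.2 ⟨by positivity, ?_⟩
      nlinarith [sq_abs r, abs_nonneg r]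
    simp only
    linarith [le_abs_self r]

theorem exists_nhds_sup_estimate (hΩ : IsOpen Ω) (hb : ∀ i, ContDiffOn ℝ (⊤ : ℕ∞) (b i) Ω)
    (hdiv : DivFree Ω b) (hspan : Hormander Ω b) (hx₀ : x₀ ∈ Ω) :
    ∃ U ∈ 𝓝 x₀, ∃ C, 0 ≤ C ∧ ∀ u : (Fin n → ℝ) → ℝ, ContDiffOn ℝ 2 u Ω → IntegrableOn u Ω →
      (∀ x ∈ Ω, 0 ≤ subLap b u x) → ∀ x ∈ U, u x ≤ C * ∫ z in Ω, |u z| := by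
  obtain ⟨r, hr, hrΩ⟩ := Metric.nhds_basis_closedBall.mem_iff.1 (hΩ.mem_nhds hx₀)
  set R := r / 3 with hR
  have hR0 : 0 < R := by positivity
  let χ : ContDiffBump x₀ := ⟨2 * R, r, by positivity, by rw [hR]; linarith⟩
  have hχ : IsTest ⊤ χ := ⟨χ.contDiff, χ.hasCompactSupport⟩
  have hχΩ : tsupport χ ⊆ Ω := by rw [χ.tsupport_eq]; exact hrΩ
  have hχ1 : ∀ x ∈ Metric.closedBall x₀ R, ∀ᶠ y in 𝓝 x, χ y = 1 := fun x hx => by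
    have : x ∈ Metric.ball x₀ (2 * R) :=
      Metric.closedBall_subset_ball (by linarith) hx
    filter_upwards [Metric.isOpen_ball.mem_nhds this] with y hy
    exact χ.one_of_mem_closedBall (Metric.ball_subset_closedBall hy)
  have hRΩ : Metric.closedBall x₀ R ⊆ Ω :=
    (Metric.closedBall_subset_closedBall (by rw [hR]; linarith)).trans hrΩ
  set B : Fin m → (Fin n → ℝ) → (Fin n → ℝ) := fun i x => χ x • b i x with hBdef
  have hB : ∀ i, IsTest ⊤ (B i) := fun i => isTest_smul_of_contDiffOn hΩ hχ hχΩ (hb i)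
  have hBb : ∀ x ∈ Metric.closedBall x₀ R, ∀ i, B i =ᶠ[𝓝 x] b i := fun x hx i => by
    filter_upwards [hχ1 x hx] with y hy
    rw [hBdef]; simp [hy]
  have hx₀R : x₀ ∈ Metric.closedBall x₀ R := Metric.mem_closedBall_self hR0.le
  obtain ⟨U, hU, hxU, C, hC, hsup⟩ := exists_local_bound hB
    (span_lieGen_eq_top (hBb x₀ hx₀R) (hspan x₀ hx₀)) hR0
    fun i x hx => (divergence_congr (hBb x hx i)).trans (hdiv i x (hRΩ hx))
  refine ⟨U ∩ Metric.ball x₀ R, inter_mem (hU.mem_nhds hxU) (Metric.ball_mem_nhds _ hR0), 2 * C,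
    by positivity, fun u hu hui hsub x hx => ?_⟩
  set uχ : (Fin n → ℝ) → ℝ := fun x => χ x • u x with huχdef
  have huχ : IsTest 2 uχ := isTest_smul_of_contDiffOn hΩ (hχ.mono le_top) hχΩ hu
  have huχu : ∀ x ∈ Metric.closedBall x₀ R, uχ =ᶠ[𝓝 x] u := fun x hx => by
    filter_upwards [hχ1 x hx] with y hy
    rw [huχdef]; simp [hy]
  have hcpt : IsCompact (Metric.closedBall x₀ R) := isCompact_closedBall x₀ R
  have hI : ∫ y in Metric.closedBall x₀ R, |uχ y| ≤ ∫ z in Ω, |u z| := by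
    rw [setIntegral_congr_fun (g := fun y => |u y|) hcpt.measurableSet
      fun y hy => congrArg abs (huχu y hy).eq_of_nhds]
    exact setIntegral_mono_set hui.abs (Eventually.of_forall fun _ => abs_nonneg _)
      (Eventually.of_forall hRΩ)
  set V := volume.real (Metric.closedBall x₀ R)
  have bound : ∀ η : ℝ, 0 < η → u x ≤ 2 * C * (∫ z in Ω, |u z|) + C * V * η := by
    intro η hη
    obtain ⟨F, F', F'', hFs, hF, hF', h1, h2, h3, h4, h5⟩ := exists_smooth_convex_majorant hη
    have hw : ContDiff ℝ 2 fun y => F (uχ y) := hFs.comp huχ.smooth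
    have key := hsup _ hw (fun y => h3 _) (fun y hy => subLap_comp_nonneg hB huχ.smooth hF hF' h1 h2
      ((subLap_congr (hBb y hy) (huχu y hy)).symm ▸ hsub y (hRΩ hy))) x hx.1
    have hux : u x ≤ F (uχ x) := by
      rw [← (huχu x (Metric.ball_subset_closedBall hx.2)).eq_of_nhds]
      exact h4 _
    have h_int : ∫ y in Metric.closedBall x₀ R, F (uχ y) ≤
        2 * (∫ y in Metric.closedBall x₀ R, |uχ y|) + V * η := by
      have i1 : IntegrableOn (fun y => 2 * |uχ y|) (Metric.closedBall x₀ R) :=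
        (huχ.abs.integrable.const_mul 2).integrableOn
      have i2 : IntegrableOn (fun _ => η) (Metric.closedBall x₀ R) :=
        integrableOn_const hcpt.measure_lt_top.ne
      calc _ ≤ ∫ y in Metric.closedBall x₀ R, (2 * |uχ y| + η) :=
            setIntegral_mono (hw.continuous.continuousOn.integrableOn_compact hcpt) (i1.add i2)
              fun y => h5 _
        _ = _ := by
            rw [integral_add i1 i2, integral_const_mul]
            simp [V]
    have := mul_le_mul_of_nonneg_left (h_int.trans (add_le_add
      (mul_le_mul_of_nonneg_left hI zero_le_two) le_rfl)) hC
    linarith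
  have hlim : Tendsto (fun η : ℝ => 2 * C * (∫ z in Ω, |u z|) + C * V * η) (𝓝[>] 0)
      (𝓝 (2 * C * (∫ z in Ω, |u z|) + C * V * 0)) := by
    have : Continuous fun η : ℝ => 2 * C * (∫ z in Ω, |u z|) + C * V * η := by fun_prop
    exact this.continuousAt.mono_left nhdsWithin_le_nhds
  rw [mul_zero, add_zero] at hlim
  exact ge_of_tendsto hlim (eventually_mem_nhdsWithin.mono bound)

end Localization

/-- estimate (3.2). Local sup bound for functions subharmonic with
respect to the sub-Laplacian: `sup_{Ω'} u ≤ C ∫_Ω |u|`. -/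
theorem sup_estimate_subharmonic (n m : ℕ) (Ω : Set (Fin n → ℝ))
    (hΩo : IsOpen Ω) (hΩb : Bornology.IsBounded Ω)
    (b : Fin m → (Fin n → ℝ) → (Fin n → ℝ))
    (hb : ∀ i, ContDiffOn ℝ (⊤ : ℕ∞) (b i) (closure Ω))
    (hcond1 : DivFree Ω b) (hcond2 : Hormander Ω b) :
    ∀ Ω' : Set (Fin n → ℝ), CptIn Ω' Ω →
      ∃ C > (0 : ℝ), ∀ u : (Fin n → ℝ) → ℝ,
        ContDiffOn ℝ 2 u Ω → MeasureTheory.IntegrableOn u Ω →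
        (∀ x ∈ Ω, 0 ≤ subLap b u x) →
        ∀ x ∈ Ω', u x ≤ C * ∫ z in Ω, |u z| := by
  rintro Ω' ⟨-, hcpt, hsubset⟩
  have hI : ∀ u : (Fin n → ℝ) → ℝ, 0 ≤ ∫ z in Ω, |u z| := fun u =>
    integral_nonneg fun _ => abs_nonneg _
  obtain ⟨C, hC, h⟩ : ∃ C, 0 ≤ C ∧ ∀ u : (Fin n → ℝ) → ℝ, ContDiffOn ℝ 2 u Ω →
      IntegrableOn u Ω → (∀ x ∈ Ω, 0 ≤ subLap b u x) →
        ∀ x ∈ closure Ω', u x ≤ C * ∫ z in Ω, |u z| := by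
    refine hcpt.induction_on (p := fun S => ∃ C, 0 ≤ C ∧ ∀ u : (Fin n → ℝ) → ℝ,
      ContDiffOn ℝ 2 u Ω → IntegrableOn u Ω → (∀ x ∈ Ω, 0 ≤ subLap b u x) →
        ∀ x ∈ S, u x ≤ C * ∫ z in Ω, |u z|) ⟨0, le_rfl, by simp⟩ ?_ ?_ ?_
    · rintro S S' hS ⟨C, hC, h⟩
      exact ⟨C, hC, fun u hu hui hsub x hx => h u hu hui hsub x (hS hx)⟩
    · rintro S S' ⟨C, hC, h⟩ ⟨C', hC', h'⟩
      refine ⟨C + C', add_nonneg hC hC', fun u hu hui hsub x hx => ?_⟩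
      have p := mul_nonneg hC (hI u)
      have p' := mul_nonneg hC' (hI u)
      rw [add_mul]
      rcases hx with hx | hx
      · linarith [h u hu hui hsub x hx]
      · linarith [h' u hu hui hsub x hx]
    · intro x hx
      obtain ⟨U, hU, hUC⟩ := exists_nhds_sup_estimate hΩo
        (fun i => (hb i).mono subset_closure) hcond1 hcond2 (hsubset hx)
      exact ⟨U, mem_nhdsWithin_of_mem_nhds hU, hUC⟩
  refine ⟨C + 1, by linarith, fun u hu hui hsub x hx => ?_⟩
  have := h u hu hui hsub x (subset_closure hx)
  linarith [hI u]
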